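/- Let α > 0 and let g : ℝ² → ℂ be a Schwartz function. For j ∈ ℤ define V_j : ℝ² → ℂ by V_j(x₁,x₂) := −∫_ℝ e^{2πix₂ξ}·φ_j(ξ)·(α² + 16π²ξ²)^(−1/2)·( λ₋(α,2πξ)·∫_{−∞}^{x₁} e^{λ₋(α,2πξ)(x₁−y)} ĝ(y,ξ) dy + λ₊(α,2πξ)·∫_{x₁}^{∞} e^{λ₊(α,2πξ)(x₁−y)} ĝ(y,ξ) dy ) dξ (all integrals converge absolutely); this is the block Δ_j of the operator 𝒟^{(1)} applied to g. Then there exists a constant C > 0, independent of α, g, j and the exponents, such that for all p₁, p₂, p₃ ∈ [1,∞] with p₃ ≤ p₁: if 2^j > α then ‖V_j‖_{L^{p₁}L^{p₂}} ≤ C·2^{(−1+1/p₃−1/p₁)j}·‖Δ_j g‖_{L^{p₃}L^{p₂}}, and if 2^j ≤ α then ‖V_j‖_{L^{p₁}L^{p₂}} ≤ C·α^{−1+1/p₃−1/p₁}·‖Δ_j g‖_{L^{p₃}L^{p₂}} (with 1/∞ := 0). -/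

import Mathlib

open MeasureTheory Real Complex
open scoped FourierTransform ENNReal SchwartzMap

noncomputable section

/-- `λ₊(α,ξ) = (α + √(α² + 4ξ²))/2`. -/
def lamP (α ξ : ℝ) : ℝ := (α + Real.sqrt (α ^ 2 + 4 * ξ ^ 2)) / 2

/-- `λ₋(α,ξ) = (α − √(α² + 4ξ²))/2`. -/
def lamM (α ξ : ℝ) : ℝ := (α - Real.sqrt (α ^ 2 + 4 * ξ ^ 2)) / 2

/-- Partial Fourier transform in the second variable:
`ĝ(y,ξ) = ∫ e^{-2πi x₂ ξ} g(y,x₂) dx₂`. -/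
def pFT (g : ℝ × ℝ → ℂ) (y ξ : ℝ) : ℂ := 𝓕 (fun x₂ : ℝ => g (y, x₂)) ξ

/-- Littlewood–Paley block in the second variable:
`Δ_j g(x₁,x₂) = ∫ e^{2πi x₂ ξ} φ_j(ξ) ĝ(x₁,ξ) dξ`. -/
def LPblock (φ₀ : ℝ → ℝ) (j : ℤ) (g : ℝ × ℝ → ℂ) (x₁ x₂ : ℝ) : ℂ :=
  𝓕⁻ (fun ξ : ℝ => (φ₀ ((2:ℝ) ^ (-j) * ξ) : ℂ) * pFT g x₁ ξ) x₂

/-- Mixed norm `L^{p₁}_{x₁} L^{p₂}_{x₂}` of `h : ℝ → ℝ → ℂ`. -/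
def mixedNorm (p₁ p₂ : ℝ≥0∞) (h : ℝ → ℝ → ℂ) : ℝ≥0∞ :=
  if p₁ = ∞ then essSup (fun x₁ : ℝ => eLpNorm (h x₁) p₂ volume) volume
  else (∫⁻ x₁ : ℝ, (eLpNorm (h x₁) p₂ volume) ^ p₁.toReal) ^ (1 / p₁.toReal)

/-- The block `Δ_j` of `𝒟^{(1)}[g]`. -/
def Vop (φ₀ : ℝ → ℝ) (α : ℝ) (j : ℤ) (g : ℝ × ℝ → ℂ) (x₁ x₂ : ℝ) : ℂ :=
  -𝓕⁻ (fun ξ : ℝ =>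
      (φ₀ ((2:ℝ) ^ (-j) * ξ) : ℂ) *
        (((α ^ 2 + 16 * π ^ 2 * ξ ^ 2) ^ (-(1:ℝ)/2) : ℝ) : ℂ) *
        ((lamM α (2 * π * ξ) : ℂ) *
            (∫ y in Set.Iic x₁, (Real.exp (lamM α (2 * π * ξ) * (x₁ - y)) : ℂ) * pFT g y ξ) +
          (lamP α (2 * π * ξ) : ℂ) *
            ∫ y in Set.Ici x₁, (Real.exp (lamP α (2 * π * ξ) * (x₁ - y)) : ℂ) * pFT g y ξ)) x₂

/-- Jensen's inequality for a weight `w`, in `ℝ≥0∞`. -/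
theorem rpow_lintegral_mul_le {X : Type*} [MeasurableSpace X] {μ : Measure X} {w f : X → ℝ≥0∞}
    (hw : Measurable w) (hf : Measurable f) {p : ℝ} (hp : 1 ≤ p) :
    (∫⁻ x, w x * f x ∂μ) ^ p ≤ (∫⁻ x, w x ∂μ) ^ (p - 1) * ∫⁻ x, w x * f x ^ p ∂μ := by
  rcases hp.eq_or_lt with rfl | hp
  · simp
  have hpq := Real.HolderConjugate.conjExponent hp
  set q := p.conjExponent
  have hp0 : 0 < p := hpq.pos
  have hq0 : 0 < q := hpq.symm.pos
  have key := ENNReal.lintegral_mul_le_Lp_mul_Lq μ hpq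
    (f := fun x => w x ^ (1 / p) * f x) (g := fun x => w x ^ (1 / q))
    (by fun_prop) (by fun_prop)
  have e1 : ∀ x, ((fun x => w x ^ (1 / p) * f x) * fun x => w x ^ (1 / q)) x = w x * f x := by
    intro x
    have h1 : w x ^ (1 / p) * w x ^ (1 / q) = w x := by
      rw [← ENNReal.rpow_add_of_nonneg _ _ (by positivity) (by positivity),
        hpq.one_div_add_one_div, one_div_one, ENNReal.rpow_one]
    calc _ = (w x ^ (1 / p) * w x ^ (1 / q)) * f x := by simp only [Pi.mul_apply]; ring
      _ = _ := by rw [h1]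
  have e2 : ∀ x, (w x ^ (1 / p) * f x) ^ p = w x * f x ^ p := by
    intro x
    rw [ENNReal.mul_rpow_of_nonneg _ _ hp0.le, ← ENNReal.rpow_mul, one_div_mul_cancel hp0.ne',
      ENNReal.rpow_one]
  have e3 : ∀ x, (w x ^ (1 / q)) ^ q = w x := by
    intro x
    rw [← ENNReal.rpow_mul, one_div_mul_cancel hq0.ne', ENNReal.rpow_one]
  simp only [e1, e2, e3] at key
  calc (∫⁻ x, w x * f x ∂μ) ^ p
      ≤ ((∫⁻ x, w x * f x ^ p ∂μ) ^ (1 / p) * (∫⁻ x, w x ∂μ) ^ (1 / q)) ^ p := by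
        gcongr
    _ = _ := by
        rw [ENNReal.mul_rpow_of_nonneg _ _ hp0.le, ← ENNReal.rpow_mul, ← ENNReal.rpow_mul,
          one_div_mul_cancel hp0.ne', ENNReal.rpow_one, mul_comm]
        congr 2
        have := hpq.one_div_add_one_div
        have h2 : 1 / q = 1 - 1 / p := by linarith
        rw [h2]; field_simp

/-- Minkowski's integral inequality, finite exponent. -/
theorem lintegral_rpow_lintegral_le {X Y : Type*} [MeasurableSpace X] [MeasurableSpace Y]
    {μ : Measure X} {ν : Measure Y} [SFinite μ] [SFinite ν] {F : Y → X → ℝ≥0∞}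
    (hF : Measurable (Function.uncurry F)) {p : ℝ} (hp : 1 ≤ p) :
    (∫⁻ x, (∫⁻ t, F t x ∂ν) ^ p ∂μ) ^ (1 / p)
      ≤ ∫⁻ t, (∫⁻ x, F t x ^ p ∂μ) ^ (1 / p) ∂ν := by
  have hp0 : 0 < p := by linarith
  set N : Y → ℝ≥0∞ := fun t => (∫⁻ x, F t x ^ p ∂μ) ^ (1 / p) with hN
  have hNm : Measurable N := by
    have : Measurable (Function.uncurry fun t x => F t x ^ p) := by
      simpa [Function.uncurry_def] using hF.pow_const p
    exact (this.lintegral_prod_right').pow_const _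
  have hNp : ∀ t, ∫⁻ x, F t x ^ p ∂μ = N t ^ p := by
    intro t
    rw [hN, ← ENNReal.rpow_mul, one_div_mul_cancel hp0.ne', ENNReal.rpow_one]
  by_cases hfin : ∫⁻ t, N t ∂ν = ∞
  · rw [hfin]; exact le_top
  have hNtop : ∀ᵐ t ∂ν, N t < ∞ := ae_lt_top hNm hfin
  have hFa : ∀ t, Measurable (F t) := fun t => hF.comp measurable_prodMk_left
  have hFb : ∀ x, Measurable fun t => F t x := fun x => hF.comp measurable_prodMk_right
  have hzero : ∀ᵐ x ∂μ, ∀ᵐ t ∂ν, N t = 0 → F t x = 0 := by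
    have hms : MeasurableSet {z : Y × X | N z.1 = 0 → F z.1 z.2 = 0} := by
      have h1 : MeasurableSet {z : Y × X | N z.1 = 0} :=
        (hNm.comp measurable_fst) (measurableSet_singleton 0)
      have h2 : MeasurableSet {z : Y × X | F z.1 z.2 = 0} := hF (measurableSet_singleton 0)
      have : {z : Y × X | N z.1 = 0 → F z.1 z.2 = 0}
          = {z : Y × X | N z.1 = 0}ᶜ ∪ {z : Y × X | F z.1 z.2 = 0} := by
        ext z; simp [imp_iff_not_or]
      rw [this]; exact h1.compl.union h2
    have h3 : ∀ᵐ t ∂ν, ∀ᵐ x ∂μ, N t = 0 → F t x = 0 := by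
      refine Filter.Eventually.of_forall fun t => ?_
      by_cases ht : N t = 0
      · have h4 : ∫⁻ x, F t x ^ p ∂μ = 0 := by rw [hNp, ht, ENNReal.zero_rpow_of_pos hp0]
        rw [lintegral_eq_zero_iff ((hFa t).pow_const p)] at h4
        filter_upwards [h4] with x hx _
        simpa [hp0, hp0.le, not_lt.2 hp0.le] using hx
      · exact Filter.Eventually.of_forall fun x h => absurd h ht
    exact (Measure.ae_ae_comm hms).1 h3
  have hpt : ∀ᵐ x ∂μ, (∫⁻ t, F t x ∂ν) ^ p
      ≤ (∫⁻ t, N t ∂ν) ^ (p - 1) * ∫⁻ t, N t * (F t x / N t) ^ p ∂ν := by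
    filter_upwards [hzero] with x hx
    have : ∫⁻ t, F t x ∂ν = ∫⁻ t, N t * (F t x / N t) ∂ν := by
      refine lintegral_congr_ae ?_
      filter_upwards [hx, hNtop] with t h1 h2
      by_cases ht : N t = 0
      · simp [ht, h1 ht]
      · rw [ENNReal.mul_div_cancel ht h2.ne]
    rw [this]
    exact rpow_lintegral_mul_le hNm ((hFb x).div hNm) hp
  have hmain : ∫⁻ x, (∫⁻ t, F t x ∂ν) ^ p ∂μ ≤ (∫⁻ t, N t ∂ν) ^ p := by
    have hm : Measurable (Function.uncurry fun (x : X) (t : Y) => N t * (F t x / N t) ^ p) := by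
      have h1 : Measurable fun z : X × Y => F z.2 z.1 := hF.comp measurable_swap
      have h2 : Measurable fun z : X × Y => N z.2 := hNm.comp measurable_snd
      exact h2.mul ((h1.div h2).pow_const p)
    calc ∫⁻ x, (∫⁻ t, F t x ∂ν) ^ p ∂μ
        ≤ ∫⁻ x, (∫⁻ t, N t ∂ν) ^ (p - 1) * ∫⁻ t, N t * (F t x / N t) ^ p ∂ν ∂μ :=
          lintegral_mono_ae hpt
      _ = (∫⁻ t, N t ∂ν) ^ (p - 1) * ∫⁻ t, ∫⁻ x, N t * (F t x / N t) ^ p ∂μ ∂ν := by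
          have hm' : Measurable fun x => ∫⁻ t, N t * (F t x / N t) ^ p ∂ν := hm.lintegral_prod_right'
          rw [lintegral_const_mul _ hm', lintegral_lintegral_swap hm.aemeasurable]
      _ ≤ (∫⁻ t, N t ∂ν) ^ (p - 1) * ∫⁻ t, N t ∂ν := by
          refine mul_le_mul' le_rfl ?_
          refine lintegral_mono_ae ?_
          filter_upwards [hNtop] with t ht
          rw [lintegral_const_mul _ (((hFa t).div_const _).pow_const p)]
          by_cases h0 : N t = 0
          · simp [h0]
          refine mul_le_of_le_one_right' ?_
          simp only [div_eq_mul_inv, ENNReal.mul_rpow_of_nonneg _ _ hp0.le]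
          rw [lintegral_mul_const _ ((hFa t).pow_const p), hNp, ← ENNReal.mul_rpow_of_nonneg _ _ hp0.le,
            ENNReal.mul_inv_cancel h0 ht.ne, ENNReal.one_rpow]
      _ = (∫⁻ t, N t ∂ν) ^ p := by
          nth_rewrite 2 [← ENNReal.rpow_one (∫⁻ t, N t ∂ν)]
          rw [← ENNReal.rpow_add_of_nonneg _ _ (by linarith) zero_le_one]
          congr 1; ring
  calc _ ≤ ((∫⁻ t, N t ∂ν) ^ p) ^ (1 / p) := by gcongr
    _ = _ := by rw [← ENNReal.rpow_mul, mul_one_div_cancel hp0.ne', ENNReal.rpow_one]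

theorem enorm_le_eLpNorm_top_of_continuous {f : ℝ → ℂ} (hf : Continuous f) (x : ℝ) :
    ‖f x‖ₑ ≤ eLpNorm f ∞ volume := by
  rw [eLpNorm_exponent_top]
  by_contra! h
  have h1 : IsOpen {x | eLpNormEssSup f volume < ‖f x‖ₑ} :=
    isOpen_lt continuous_const hf.enorm
  have h2 : volume {x | eLpNormEssSup f volume < ‖f x‖ₑ} = 0 := by
    have := enorm_ae_le_eLpNormEssSup f volume
    rw [ae_iff] at this
    simpa using this
  have h3 := (h1.measure_eq_zero_iff volume).1 h2
  exact Set.eq_empty_iff_forall_notMem.1 h3 x h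

/-- The slice norms of a jointly continuous function are lower semicontinuous, hence measurable. -/
theorem measurable_eLpNorm_slice {D : ℝ → ℝ → ℂ} (hD : Continuous (Function.uncurry D))
    (p : ℝ≥0∞) : Measurable fun y => eLpNorm (D y) p volume := by
  have hs : ∀ y, Continuous (D y) := fun y => hD.comp (by fun_prop : Continuous fun x => (y, x))
  refine measurable_of_Iic fun c => IsClosed.measurableSet ?_
  refine IsSeqClosed.isClosed fun u y hu huy => ?_
  have h1 := Lp.eLpNorm_lim_le_liminf_eLpNorm (p := p) (μ := (volume : Measure ℝ))
    (f := fun n => D (u n)) (fun n => (hs _).aestronglyMeasurable) (D y)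
    (Filter.Eventually.of_forall fun x =>
      ((hD.comp (by fun_prop : Continuous fun y => (y, x))).tendsto y).comp huy)
  refine h1.trans ?_
  refine Filter.liminf_le_of_le (by isBoundedDefault) fun b hb => ?_
  obtain ⟨n, hn⟩ := hb.exists
  exact hn.trans (hu n)

/-- Minkowski's inequality for a superposition of translates. -/
theorem eLpNorm_le_of_enorm_le_lintegral {D : ℝ → ℝ → ℂ} (hD : Continuous (Function.uncurry D))
    {A w : ℝ → ℝ≥0∞} (hA : Measurable A) (hw : Measurable w) {p : ℝ≥0∞} (hp : 1 ≤ p) {V : ℝ → ℂ}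
    (hV : ∀ x, ‖V x‖ₑ ≤ ∫⁻ y, ∫⁻ u, A y * w u * ‖D y (x - u)‖ₑ) :
    eLpNorm V p volume ≤ (∫⁻ u, w u) * ∫⁻ y, A y * eLpNorm (D y) p volume := by
  have hs : ∀ y, Continuous (D y) := fun y => hD.comp (by fun_prop : Continuous fun x => (y, x))
  have hN := measurable_eLpNorm_slice hD p
  have hfac : (∫⁻ y, ∫⁻ u, A y * w u * eLpNorm (D y) p volume)
      = (∫⁻ u, w u) * ∫⁻ y, A y * eLpNorm (D y) p volume := by
    rw [← lintegral_const_mul _ (by fun_prop)]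
    refine lintegral_congr fun y => ?_
    rw [← lintegral_mul_const _ hw]
    refine lintegral_congr fun u => ?_
    ring
  rw [← hfac]
  rcases eq_or_ne p ∞ with rfl | htop
  · rw [eLpNorm_exponent_top]
    refine eLpNormEssSup_le_of_ae_enorm_bound (Filter.Eventually.of_forall fun x => ?_)
    refine (hV x).trans ?_
    gcongr with y u
    exact enorm_le_eLpNorm_top_of_continuous (hs y) _
  have hp0 : p ≠ 0 := (zero_lt_one.trans_le hp).ne'
  have hp1 : 1 ≤ p.toReal := by
    simpa using (ENNReal.toReal_le_toReal ENNReal.one_ne_top htop).2 hp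
  have hpp : 0 < p.toReal := by linarith
  have hFm : Measurable (Function.uncurry fun (t : ℝ × ℝ) (x : ℝ) =>
      A t.1 * w t.2 * ‖D t.1 (x - t.2)‖ₑ) := by
    have : Continuous fun z : (ℝ × ℝ) × ℝ => D z.1.1 (z.2 - z.1.2) :=
      hD.comp (by fun_prop : Continuous fun z : (ℝ × ℝ) × ℝ => (z.1.1, z.2 - z.1.2))
    have h2 := this.measurable.enorm
    simp only [Function.uncurry_def]
    fun_prop
  have hFb : ∀ x, AEMeasurable (fun (t : ℝ × ℝ) => A t.1 * w t.2 * ‖D t.1 (x - t.2)‖ₑ)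
      (volume.prod volume) := fun x => (hFm.comp measurable_prodMk_right).aemeasurable
  have hmk := lintegral_rpow_lintegral_le (μ := (volume : Measure ℝ))
    (ν := (volume : Measure ℝ).prod volume) hFm hp1
  rw [eLpNorm_eq_lintegral_rpow_enorm_toReal hp0 htop]
  calc _ ≤ (∫⁻ x, (∫⁻ t, A t.1 * w t.2 * ‖D t.1 (x - t.2)‖ₑ
          ∂(volume : Measure ℝ).prod volume) ^ p.toReal) ^ (1 / p.toReal) := by
        gcongr with x
        rw [lintegral_prod _ (hFb x)]
        exact hV x
    _ ≤ _ := hmk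
    _ = ∫⁻ t, A t.1 * w t.2 * eLpNorm (D t.1) p volume ∂(volume : Measure ℝ).prod volume := by
        refine lintegral_congr fun t => ?_
        have : ∀ x, (A t.1 * w t.2 * ‖D t.1 (x - t.2)‖ₑ) ^ p.toReal
            = (A t.1 * w t.2) ^ p.toReal * ‖D t.1 (x - t.2)‖ₑ ^ p.toReal := fun x =>
          ENNReal.mul_rpow_of_nonneg _ _ hpp.le
        simp only [this]
        have hm : Measurable fun x => ‖D t.1 (x - t.2)‖ₑ ^ p.toReal :=
          (((hs t.1).comp (by fun_prop : Continuous fun x => x - t.2)).measurable.enorm).pow_const _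
        rw [lintegral_const_mul _ hm, ENNReal.mul_rpow_of_nonneg _ _ (by positivity),
          ← ENNReal.rpow_mul, mul_one_div_cancel hpp.ne', ENNReal.rpow_one,
          eLpNorm_eq_lintegral_rpow_enorm_toReal hp0 htop,
          lintegral_sub_right_eq_self (fun x => ‖D t.1 x‖ₑ ^ p.toReal) t.2]
    _ = _ := by
        rw [lintegral_prod]
        have hNf : Measurable fun t : ℝ × ℝ => eLpNorm (D t.1) p volume := hN.comp measurable_fst
        fun_prop

/-- Young's convolution inequality for mixed norms, with a bounded integrable majorant. -/
theorem mixedNorm_le_of_slice_le {D V : ℝ → ℝ → ℂ} (hD : Continuous (Function.uncurry D))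
    {A : ℝ → ℝ≥0∞} (hA : Measurable A) {S L W : ℝ≥0∞} (hS : ∀ z, A z ≤ S) (hL : ∫⁻ z, A z ≤ L)
    {p₁ p₂ p₃ : ℝ≥0∞} (h3 : 1 ≤ p₃) (h31 : p₃ ≤ p₁)
    (hV : ∀ x, eLpNorm (V x) p₂ volume ≤ W * ∫⁻ y, A (x - y) * eLpNorm (D y) p₂ volume) :
    mixedNorm p₁ p₂ V ≤ W * (S ^ ((1 / p₃).toReal - (1 / p₁).toReal)
      * L ^ (1 - (1 / p₃).toReal + (1 / p₁).toReal)) * mixedNorm p₃ p₂ D := by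
  set N : ℝ → ℝ≥0∞ := fun y => eLpNorm (D y) p₂ volume with hNdef
  have hN : Measurable N := measurable_eLpNorm_slice hD p₂
  have hLx : ∀ x, ∫⁻ y, A (x - y) ≤ L := fun x => by
    rwa [lintegral_sub_left_eq_self A x]
  set h : ℝ → ℝ≥0∞ := fun x => ∫⁻ y, A (x - y) * N y with hh
  rcases eq_or_ne p₃ ∞ with rfl | h3t
  · obtain rfl : p₁ = ∞ := top_le_iff.1 h31
    simp only [mixedNorm, if_true]
    simp only [one_div, ENNReal.inv_top, ENNReal.toReal_zero, sub_self, sub_zero, add_zero,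
      ENNReal.rpow_zero, ENNReal.rpow_one, one_mul]
    refine essSup_le_of_ae_le _ (Filter.Eventually.of_forall fun x => (hV x).trans ?_)
    rw [mul_assoc]
    refine mul_le_mul' le_rfl ?_
    have hN' : ∀ᵐ y, N y ≤ essSup N volume := ENNReal.ae_le_essSup N
    calc ∫⁻ y, A (x - y) * N y ≤ ∫⁻ y, A (x - y) * essSup N volume := by
          refine lintegral_mono_ae ?_
          filter_upwards [hN'] with y hy
          gcongr
      _ = (∫⁻ y, A (x - y)) * essSup N volume := lintegral_mul_const _ (by fun_prop)
      _ ≤ _ := by gcongr; exact hLx x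
  have h30 : p₃ ≠ 0 := (zero_lt_one.trans_le h3).ne'
  set p := p₃.toReal with hpdef
  have hp1 : 1 ≤ p := by
    simpa using (ENNReal.toReal_le_toReal ENNReal.one_ne_top h3t).2 h3
  have hp0 : 0 < p := by linarith
  have hp3 : (1 / p₃).toReal = 1 / p := by simp [hpdef]
  set J := ∫⁻ y, N y ^ p with hJ
  have hj : ∀ x, h x ^ p ≤ L ^ (p - 1) * ∫⁻ y, A (x - y) * N y ^ p := fun x => by
    refine (rpow_lintegral_mul_le (by fun_prop) hN hp1).trans ?_
    exact mul_le_mul' (ENNReal.rpow_le_rpow (hLx x) (by linarith)) le_rfl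
  have hsup : ∀ x, h x ^ p ≤ L ^ (p - 1) * (S * J) := fun x => by
    refine (hj x).trans ?_
    gcongr
    rw [hJ, ← lintegral_const_mul _ (by fun_prop)]
    gcongr
    exact hS _
  have hint : ∫⁻ x, h x ^ p ≤ L ^ p * J := by
    have hm : Measurable (Function.uncurry fun x y => A (x - y) * N y ^ p) := by
      simp only [Function.uncurry_def]; fun_prop
    have hm' : Measurable fun x => ∫⁻ y, A (x - y) * N y ^ p := hm.lintegral_prod_right'
    calc ∫⁻ x, h x ^ p ≤ ∫⁻ x, L ^ (p - 1) * ∫⁻ y, A (x - y) * N y ^ p := lintegral_mono hj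
      _ = L ^ (p - 1) * ∫⁻ y, ∫⁻ x, A (x - y) * N y ^ p := by
          rw [lintegral_const_mul _ hm', lintegral_lintegral_swap hm.aemeasurable]
      _ ≤ L ^ (p - 1) * (L * J) := by
          gcongr
          rw [hJ, ← lintegral_const_mul _ (by fun_prop)]
          gcongr with y
          rw [lintegral_mul_const _ (by fun_prop), lintegral_sub_right_eq_self A y]
          gcongr
      _ = L ^ p * J := by
          rw [← mul_assoc]
          nth_rewrite 2 [← ENNReal.rpow_one L]
          rw [← ENNReal.rpow_add_of_nonneg _ _ (by linarith) zero_le_one, sub_add_cancel]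
  have hD3 : mixedNorm p₃ p₂ D = J ^ (1 / p) := by simp [mixedNorm, h3t, hJ, hNdef, hpdef]
  rw [hD3, hp3]
  rcases eq_or_ne p₁ ∞ with rfl | h1t
  · simp only [mixedNorm, if_true]
    simp only [one_div, ENNReal.inv_top, ENNReal.toReal_zero, sub_zero, add_zero]
    refine essSup_le_of_ae_le _ (Filter.Eventually.of_forall fun x => (hV x).trans ?_)
    rw [mul_assoc]
    refine mul_le_mul' le_rfl ?_
    change h x ≤ _
    calc h x = (h x ^ p) ^ p⁻¹ := by rw [← ENNReal.rpow_mul, mul_inv_cancel₀ hp0.ne', ENNReal.rpow_one]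
      _ ≤ (L ^ (p - 1) * (S * J)) ^ p⁻¹ := by gcongr; exact hsup x
      _ = _ := by
        rw [ENNReal.mul_rpow_of_nonneg _ _ (by positivity), ENNReal.mul_rpow_of_nonneg _ _ (by positivity),
          ← ENNReal.rpow_mul]
        have : (p - 1) * p⁻¹ = 1 - p⁻¹ := by field_simp
        rw [this]; ring
  set r := p₁.toReal with hrdef
  have hpr : p ≤ r := (ENNReal.toReal_le_toReal h3t h1t).2 h31
  have hr0 : 0 < r := by linarith
  have hp1r : (1 / p₁).toReal = 1 / r := by simp [hrdef]
  have e1 : 0 ≤ r / p - 1 := by rw [sub_nonneg, one_le_div hp0]; exact hpr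
  have hr : ∀ x, h x ^ r = (h x ^ p) ^ (r / p - 1) * h x ^ p := fun x => by
    rw [← ENNReal.rpow_mul, ← ENNReal.rpow_add_of_nonneg _ _ (by positivity) (by positivity)]
    congr 1; field_simp; ring
  have hhm : Measurable h := by
    have hm : Measurable (Function.uncurry fun x y => A (x - y) * N y) := by
      simp only [Function.uncurry_def]; fun_prop
    exact hm.lintegral_prod_right'
  have hhr : ∫⁻ x, h x ^ r ≤ (L ^ (p - 1) * (S * J)) ^ (r / p - 1) * (L ^ p * J) := by
    calc ∫⁻ x, h x ^ r ≤ ∫⁻ x, (L ^ (p - 1) * (S * J)) ^ (r / p - 1) * h x ^ p := by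
          refine lintegral_mono fun x => ?_
          rw [hr]
          exact mul_le_mul' (ENNReal.rpow_le_rpow (hsup x) e1) le_rfl
      _ = (L ^ (p - 1) * (S * J)) ^ (r / p - 1) * ∫⁻ x, h x ^ p :=
          lintegral_const_mul _ (by fun_prop)
      _ ≤ _ := mul_le_mul' le_rfl hint
  have hV1 : mixedNorm p₁ p₂ V ≤ W * (∫⁻ x, h x ^ r) ^ (1 / r) := by
    simp only [mixedNorm, if_neg h1t, ← hrdef]
    calc (∫⁻ x, eLpNorm (V x) p₂ volume ^ r) ^ (1 / r)
        ≤ (∫⁻ x, W ^ r * h x ^ r) ^ (1 / r) := by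
          gcongr with x
          rw [← ENNReal.mul_rpow_of_nonneg _ _ hr0.le]
          gcongr
          exact hV x
      _ = W * (∫⁻ x, h x ^ r) ^ (1 / r) := by
          rw [lintegral_const_mul _ (by fun_prop), ENNReal.mul_rpow_of_nonneg _ _ (by positivity),
            ← ENNReal.rpow_mul, mul_one_div_cancel hr0.ne', ENNReal.rpow_one]
  refine hV1.trans ?_
  rw [mul_assoc, hp1r]
  refine mul_le_mul' le_rfl ?_
  refine (ENNReal.rpow_le_rpow hhr (by positivity)).trans_eq ?_
  have e2 : 0 ≤ p - 1 := by linarith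
  have e3 : 0 ≤ 1 / r := by positivity
  simp only [ENNReal.mul_rpow_of_nonneg _ _ e1, ENNReal.mul_rpow_of_nonneg _ _ e3,
    ← ENNReal.rpow_mul]
  have hLe : L ^ (1 - 1 / p + 1 / r) = L ^ ((p - 1) * (r / p - 1) * (1 / r)) * L ^ (p * (1 / r)) := by
    rw [← ENNReal.rpow_add_of_nonneg _ _ (by positivity) (by positivity)]
    congr 1; field_simp; ring
  have hJe : J ^ (1 / p) = J ^ ((r / p - 1) * (1 / r)) * J ^ (1 / r) := by
    rw [← ENNReal.rpow_add_of_nonneg _ _ (by positivity) (by positivity)]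
    congr 1; field_simp; ring
  have hSe : (r / p - 1) * (1 / r) = 1 / p - 1 / r := by field_simp
  rw [hLe, hJe, hSe]
  ring

theorem fourierInv_real_eq_mul (f : ℝ → ℂ) (x : ℝ) :
    𝓕⁻ f x = ∫ v : ℝ, (𝐞 (v * x) : ℂ) * f v := by
  rw [Real.fourierInv_eq]
  refine integral_congr_ae (Filter.Eventually.of_forall fun v => ?_)
  simp [Circle.smul_def, mul_comm]

theorem fourier_real_eq_mul (f : ℝ → ℂ) (x : ℝ) :
    𝓕 f x = ∫ v : ℝ, (𝐞 (-(v * x)) : ℂ) * f v := by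
  rw [Real.fourier_real_eq]
  rfl

theorem continuous_fourierChar_coe : Continuous fun x : ℝ => (𝐞 x : ℂ) :=
  continuous_subtype_val.comp Real.continuous_fourierChar

theorem integrable_char_mul {X : Type*} [MeasurableSpace X] {μ : Measure X}
    {a : X → ℝ} (ha : Measurable a) {f : X → ℂ} (hf : Integrable f μ) :
    Integrable (fun t => (𝐞 (a t) : ℂ) * f t) μ :=
  hf.bdd_mul (c := 1) (continuous_fourierChar_coe.measurable.comp ha).aestronglyMeasurable
    (Filter.Eventually.of_forall fun _ => (Circle.norm_coe _).le)

/-- A Fourier multiplier with integrable kernel `k` acts by convolution with `k`. -/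
theorem fourierInv_fourier_mul {k P : ℝ → ℂ} (hk : Integrable k) (hP : Integrable P) (x : ℝ) :
    𝓕⁻ (fun ξ => 𝓕 k ξ * P ξ) x = ∫ u, k u * 𝓕⁻ P (x - u) := by
  have h1 : Integrable (Function.uncurry fun ξ u : ℝ => P ξ * k u) (volume.prod volume) :=
    hP.mul_prod hk
  have h2 : Integrable (Function.uncurry fun ξ u : ℝ => (𝐞 (ξ * (x - u)) : ℂ) * (P ξ * k u))
      (volume.prod volume) :=
    integrable_char_mul (a := fun t : ℝ × ℝ => t.1 * (x - t.2)) (by fun_prop) h1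
  calc 𝓕⁻ (fun ξ => 𝓕 k ξ * P ξ) x
      = ∫ ξ, ∫ u, (𝐞 (ξ * (x - u)) : ℂ) * (P ξ * k u) := by
        rw [fourierInv_real_eq_mul]
        refine integral_congr_ae (Filter.Eventually.of_forall fun ξ => ?_)
        simp only
        rw [fourier_real_eq_mul, mul_comm _ (P ξ), ← mul_assoc, ← integral_const_mul]
        refine integral_congr_ae (Filter.Eventually.of_forall fun u => ?_)
        simp only
        have : ξ * (x - u) = ξ * x + -(u * ξ) := by ring
        rw [this, AddChar.map_add_eq_mul, Circle.coe_mul]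
        ring
    _ = ∫ u, ∫ ξ, (𝐞 (ξ * (x - u)) : ℂ) * (P ξ * k u) := integral_integral_swap h2
    _ = _ := by
        refine integral_congr_ae (Filter.Eventually.of_forall fun u => ?_)
        simp only
        rw [fourierInv_real_eq_mul, ← integral_const_mul]
        refine integral_congr_ae (Filter.Eventually.of_forall fun ξ => ?_)
        simp only
        ring

/-- Pointwise domination of a superposition of Fourier multipliers by their kernels. -/
theorem enorm_fourierInv_integral_le {P M k : ℝ → ℝ → ℂ} (hP : ∀ y, Integrable (P y))
    (hMP : Integrable (Function.uncurry fun y ξ => M y ξ * P y ξ) (volume.prod volume))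
    (hk : ∀ y, Integrable (k y)) (hkM : ∀ y ξ, 𝓕 (k y) ξ * P y ξ = M y ξ * P y ξ) (x : ℝ) :
    ‖𝓕⁻ (fun ξ => ∫ y, M y ξ * P y ξ) x‖ₑ
      ≤ ∫⁻ y, ∫⁻ u, ‖k y u‖ₑ * ‖𝓕⁻ (P y) (x - u)‖ₑ := by
  have h2 : Integrable (Function.uncurry fun y ξ : ℝ => (𝐞 (ξ * x) : ℂ) * (M y ξ * P y ξ))
      (volume.prod volume) :=
    integrable_char_mul (a := fun t : ℝ × ℝ => t.2 * x) (by fun_prop) hMP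
  have h3 : 𝓕⁻ (fun ξ => ∫ y, M y ξ * P y ξ) x = ∫ y, ∫ u, k y u * 𝓕⁻ (P y) (x - u) := by
    rw [fourierInv_real_eq_mul]
    calc _ = ∫ ξ, ∫ y, (𝐞 (ξ * x) : ℂ) * (M y ξ * P y ξ) := by
          simp only [integral_const_mul]
      _ = ∫ y, ∫ ξ, (𝐞 (ξ * x) : ℂ) * (M y ξ * P y ξ) := (integral_integral_swap h2).symm
      _ = _ := by
          refine integral_congr_ae (Filter.Eventually.of_forall fun y => ?_)
          simp only
          rw [← fourierInv_fourier_mul (hk y) (hP y), fourierInv_real_eq_mul]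
          simp only [hkM]
  rw [h3]
  refine (enorm_integral_le_lintegral_enorm _).trans (lintegral_mono fun y => ?_)
  refine (enorm_integral_le_lintegral_enorm _).trans (lintegral_mono fun u => ?_)
  rw [enorm_mul]

theorem norm_fourierInv_le_integral (f : ℝ → ℂ) (x : ℝ) : ‖𝓕⁻ f x‖ ≤ ∫ ξ, ‖f ξ‖ := by
  rw [fourierInv_real_eq_mul]
  refine (norm_integral_le_integral_norm _).trans_eq ?_
  simp only [norm_mul, Circle.norm_coe, one_mul]

/-- Quadratic decay of the inverse Fourier transform of a compactly supported `C²` function. -/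
theorem norm_fourierInv_le_of_hasDerivAt {G G₁ G₂ : ℝ → ℂ} (h1 : ∀ η, HasDerivAt G (G₁ η) η)
    (h2 : ∀ η, HasDerivAt G₁ (G₂ η) η) (hc : Continuous G₂) {R B : ℝ} (hR : 0 ≤ R)
    (hs : ∀ η, R < |η| → G η = 0 ∧ G₁ η = 0 ∧ G₂ η = 0)
    (hB : ∀ η, ‖G η‖ ≤ B ∧ ‖G₂ η‖ ≤ B) (v : ℝ) :
    ‖𝓕⁻ G v‖ ≤ 4 * R * B / (1 + v ^ 2) := by
  have hB0 : 0 ≤ B := (norm_nonneg _).trans (hB 0).1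
  have supp : ∀ {f : ℝ → ℂ}, (∀ η, R < |η| → f η = 0) → ∀ η, η ∉ Set.Icc (-R) R → f η = 0 := by
    intro f hf η hη
    refine hf η ?_
    by_contra! h
    exact hη (abs_le.1 h)
  have hGc : Continuous G := continuous_iff_continuousAt.2 fun η => (h1 η).continuousAt
  have hG1c : Continuous G₁ := continuous_iff_continuousAt.2 fun η => (h2 η).continuousAt
  have int : ∀ {f : ℝ → ℂ}, Continuous f → (∀ η, R < |η| → f η = 0) → Integrable f := by
    intro f hf h
    exact hf.integrable_of_hasCompactSupport
      (HasCompactSupport.intro isCompact_Icc (supp h))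
  have iG := int hGc fun η h => (hs η h).1
  have iG1 := int hG1c fun η h => (hs η h).2.1
  have iG2 := int hc fun η h => (hs η h).2.2
  have bd : ∀ {f : ℝ → ℂ}, (∀ η, R < |η| → f η = 0) → (∀ η, ‖f η‖ ≤ B) →
      ∫ η, ‖f η‖ ≤ 2 * R * B := by
    intro f hf h
    have : ∫ η, ‖f η‖ = ∫ η in Set.Icc (-R) R, ‖f η‖ := by
      refine (setIntegral_eq_integral_of_forall_compl_eq_zero fun η hη => ?_).symm
      rw [supp hf η hη, norm_zero]
    rw [this]
    refine (le_norm_self _).trans ((norm_setIntegral_le_of_norm_le_const (C := B)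
      (by simp) fun η _ => by simpa using h η).trans_eq ?_)
    rw [Real.volume_real_Icc_of_le (by linarith)]
    ring
  have d1 : deriv G = G₁ := funext fun η => (h1 η).deriv
  have d2 : deriv G₁ = G₂ := funext fun η => (h2 η).deriv
  have f1 := Real.fourier_deriv iG (fun η => (h1 η).differentiableAt) (d1 ▸ iG1)
  have f2 := Real.fourier_deriv iG1 (fun η => (h2 η).differentiableAt) (d2 ▸ iG2)
  rw [d1] at f1
  rw [d2, f1] at f2
  have e0 : ‖𝓕⁻ G v‖ ≤ 2 * R * B :=
    (norm_fourierInv_le_integral G v).trans (bd (fun η h => (hs η h).1) fun η => (hB η).1)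
  have e2 : ‖𝓕⁻ G₂ v‖ ≤ 2 * R * B :=
    (norm_fourierInv_le_integral G₂ v).trans (bd (fun η h => (hs η h).2.2) fun η => (hB η).2)
  have e3 : ‖𝓕⁻ G₂ v‖ = (2 * π) ^ 2 * v ^ 2 * ‖𝓕⁻ G v‖ := by
    rw [Real.fourierInv_eq_fourier_neg, Real.fourierInv_eq_fourier_neg, f2]
    simp only [smul_eq_mul, norm_mul, Complex.norm_real, Complex.norm_I, Complex.norm_ofNat,
      norm_neg, Real.norm_eq_abs, abs_of_pos Real.pi_pos, Complex.ofReal_neg]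
    rw [← sq_abs v]; ring
  rw [le_div_iff₀ (by positivity)]
  have hpi : 1 ≤ (2 * π) ^ 2 := by nlinarith [Real.pi_gt_three]
  have : v ^ 2 * ‖𝓕⁻ G v‖ ≤ (2 * π) ^ 2 * v ^ 2 * ‖𝓕⁻ G v‖ := by
    have h0 : 0 ≤ v ^ 2 * ‖𝓕⁻ G v‖ := by positivity
    nlinarith
  linarith

theorem fourierInv_comp_inv_mul (G : ℝ → ℂ) {r : ℝ} (hr : 0 < r) (u : ℝ) :
    𝓕⁻ (fun ξ => G (r⁻¹ * ξ)) u = r * 𝓕⁻ G (r * u) := by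
  rw [fourierInv_real_eq_mul, fourierInv_real_eq_mul]
  have := Measure.integral_comp_mul_left (fun η => (𝐞 (η * (r * u)) : ℂ) * G η) r⁻¹
  simp only [inv_inv, abs_of_pos hr, Complex.real_smul] at this
  rw [← this]
  refine integral_congr_ae (Filter.Eventually.of_forall fun ξ => ?_)
  simp only
  congr 3
  field_simp

theorem SchwartzMap.exists_norm_le_prod (g : 𝓢(ℝ × ℝ, ℂ)) :
    ∃ C : ℝ, 0 ≤ C ∧ ∀ y x, ‖g (y, x)‖ ≤ C * ((1 + y ^ 2)⁻¹ * (1 + x ^ 2)⁻¹) := by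
  obtain ⟨C₀, h0⟩ := g.decay 0 0
  obtain ⟨C₂, h2⟩ := g.decay 2 0
  obtain ⟨C₄, h4⟩ := g.decay 4 0
  refine ⟨C₀ + 2 * C₂ + C₄, ?_, fun y x => ?_⟩
  · have a0 := (by positivity : (0 : ℝ) ≤ _).trans (h0.2 0)
    have a2 := (by positivity : (0 : ℝ) ≤ _).trans (h2.2 0)
    have a4 := (by positivity : (0 : ℝ) ≤ _).trans (h4.2 0)
    positivity
  have b0 := h0.2 (y, x)
  have b2 := h2.2 (y, x)
  have b4 := h4.2 (y, x)
  simp only [norm_iteratedFDeriv_zero, pow_zero, one_mul] at b0 b2 b4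
  rw [← mul_inv, ← div_eq_mul_inv, le_div_iff₀ (by positivity)]
  have hy : y ^ 2 ≤ ‖(y, x)‖ ^ 2 := by
    rw [← sq_abs y]; gcongr; exact norm_fst_le (y, x)
  have hx : x ^ 2 ≤ ‖(y, x)‖ ^ 2 := by
    rw [← sq_abs x]; gcongr; exact norm_snd_le (y, x)
  calc ‖g (y, x)‖ * ((1 + y ^ 2) * (1 + x ^ 2))
      ≤ ‖g (y, x)‖ * ((1 + ‖(y, x)‖ ^ 2) * (1 + ‖(y, x)‖ ^ 2)) := by gcongr
    _ ≤ _ := by nlinarith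

theorem pFT_eq (g : ℝ × ℝ → ℂ) (y ξ : ℝ) :
    pFT g y ξ = ∫ v : ℝ, (𝐞 (-(v * ξ)) : ℂ) * g (y, v) := fourier_real_eq_mul _ _

theorem exists_norm_pFT_le (g : 𝓢(ℝ × ℝ, ℂ)) :
    ∃ C : ℝ, 0 ≤ C ∧ ∀ y ξ, ‖pFT g y ξ‖ ≤ C * (1 + y ^ 2)⁻¹ := by
  obtain ⟨C, hC, h⟩ := g.exists_norm_le_prod
  refine ⟨C * π, by positivity, fun y ξ => ?_⟩
  rw [pFT_eq]
  refine (norm_integral_le_of_norm_le (g := fun v => C * (1 + y ^ 2)⁻¹ * (1 + v ^ 2)⁻¹)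
    (integrable_inv_one_add_sq.const_mul _) (Filter.Eventually.of_forall fun v => ?_)).trans_eq ?_
  · rw [norm_mul, Circle.norm_coe, one_mul]
    exact (h y v).trans_eq (by ring)
  · rw [integral_const_mul, integral_univ_inv_one_add_sq]; ring

theorem continuous_pFT (g : 𝓢(ℝ × ℝ, ℂ)) : Continuous (Function.uncurry (pFT g)) := by
  obtain ⟨C, hC, h⟩ := g.exists_norm_le_prod
  simp only [Function.uncurry_def, pFT_eq]
  refine continuous_of_dominated (bound := fun v => C * (1 + v ^ 2)⁻¹) (fun z => ?_) (fun z => ?_)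
    (integrable_inv_one_add_sq.const_mul _) (Filter.Eventually.of_forall fun v => ?_)
  · have := continuous_fourierChar_coe
    have hg := g.continuous
    exact Continuous.aestronglyMeasurable (by fun_prop)
  · refine Filter.Eventually.of_forall fun v => ?_
    rw [norm_mul, Circle.norm_coe, one_mul]
    refine (h z.1 v).trans ?_
    gcongr
    refine mul_le_of_le_one_left (by positivity) (inv_le_one_of_one_le₀ ?_)
    nlinarith [sq_nonneg z.1]
  · have := continuous_fourierChar_coe
    have hg := g.continuous
    fun_prop

theorem continuous_fourierInv_slice {P : ℝ → ℝ → ℂ} (hP : Continuous (Function.uncurry P))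
    {b : ℝ → ℝ} (hb : Integrable b) (hPb : ∀ y ξ, ‖P y ξ‖ ≤ b ξ) :
    Continuous (Function.uncurry fun y x => 𝓕⁻ (P y) x) := by
  have := continuous_fourierChar_coe
  simp only [Function.uncurry_def, fourierInv_real_eq_mul] at hP ⊢
  refine continuous_of_dominated (bound := b) (fun z => ?_) (fun z => ?_)
    hb (Filter.Eventually.of_forall fun v => ?_)
  · have : Continuous fun v => P z.1 v := hP.comp (by fun_prop : Continuous fun v => (z.1, v))
    exact Continuous.aestronglyMeasurable (by fun_prop)
  · refine Filter.Eventually.of_forall fun v => ?_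
    rw [norm_mul, Circle.norm_coe, one_mul]
    exact hPb _ _
  · have : Continuous fun z : ℝ × ℝ => P z.1 v :=
      hP.comp (by fun_prop : Continuous fun z : ℝ × ℝ => (z.1, v))
    fun_prop

/-- The derivative in the last variable of a smooth function of several variables. -/
theorem exists_contDiffOn_hasDerivAt_slice {E : Type*} [NormedAddCommGroup E] [NormedSpace ℝ E]
    {U : Set (E × ℝ)} (hU : IsOpen U) {f : E × ℝ → ℝ} {n : ℕ} (hf : ContDiffOn ℝ (n + 1) f U) :
    ∃ f' : E × ℝ → ℝ, ContDiffOn ℝ n f' U ∧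
      ∀ p η, (p, η) ∈ U → HasDerivAt (fun t => f (p, t)) (f' (p, η)) η := by
  refine ⟨fun z => fderiv ℝ f z (0, 1), ?_, fun p η h => ?_⟩
  · exact (hf.fderiv_of_isOpen hU le_rfl).clm_apply contDiffOn_const
  · have h1 : HasFDerivAt f (fderiv ℝ f (p, η)) (p, η) :=
      ((hf.differentiableOn (by simp)).differentiableAt (hU.mem_nhds h)).hasFDerivAt
    have h2 : HasDerivAt (fun t : ℝ => (p, t)) ((0 : E), (1 : ℝ)) η :=
      (hasDerivAt_const η p).prodMk (hasDerivAt_id η)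
    exact h1.comp_hasDerivAt η h2

theorem one_add_add_sq_mul_exp_le {κ Z : ℝ} (hκ : 0 < κ) (hZ : 0 ≤ Z) :
    (1 + Z + Z ^ 2) * Real.exp (-(Z * κ)) ≤ (1 + 2 / κ + 8 / κ ^ 2) * Real.exp (-(κ / 2 * Z)) := by
  have h1 : Real.exp (-(Z * κ)) = Real.exp (-(κ / 2 * Z)) * Real.exp (-(κ / 2 * Z)) := by
    rw [← Real.exp_add]; ring_nf
  have hx : 0 ≤ κ / 2 * Z := by positivity
  have h2 := Real.quadratic_le_exp_of_nonneg hx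
  set e := Real.exp (κ / 2 * Z) with he
  have h3 : 1 + Z + Z ^ 2 ≤ (1 + 2 / κ + 8 / κ ^ 2) * e := by
    have a1 : 1 ≤ e := by nlinarith [sq_nonneg (κ / 2 * Z)]
    have a2 : Z ≤ 2 / κ * e := by
      have : κ / 2 * Z ≤ e := by nlinarith [sq_nonneg (κ / 2 * Z)]
      calc Z = 2 / κ * (κ / 2 * Z) := by field_simp
        _ ≤ _ := by gcongr
    have a3 : Z ^ 2 ≤ 8 / κ ^ 2 * e := by
      have : (κ / 2 * Z) ^ 2 / 2 ≤ e := by nlinarith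
      calc Z ^ 2 = 8 / κ ^ 2 * ((κ / 2 * Z) ^ 2 / 2) := by field_simp; norm_num
        _ ≤ _ := by gcongr
    linarith
  rw [h1, ← mul_assoc]
  gcongr
  calc _ ≤ (1 + 2 / κ + 8 / κ ^ 2) * e * Real.exp (-(κ / 2 * Z)) := by gcongr
    _ = _ := by rw [mul_assoc, he, ← Real.exp_add]; simp

theorem abs_le_of_second_derivative_terms {B Z x₀ x₁ x₂ y₁ y₂ : ℝ} (hB : 1 ≤ B) (hZ : 0 ≤ Z)
    (hx₀ : |x₀| ≤ B) (hx₁ : |x₁| ≤ B) (hx₂ : |x₂| ≤ B) (hy₁ : |y₁| ≤ B) (hy₂ : |y₂| ≤ B) :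
    |x₀| ≤ 3 * B ^ 3 * (1 + Z + Z ^ 2) ∧
      |x₂ - 2 * Z * (x₁ * y₁) - Z * (x₀ * y₂) + Z ^ 2 * (x₀ * y₁ ^ 2)|
        ≤ 3 * B ^ 3 * (1 + Z + Z ^ 2) := by
  have hB1 : B ≤ B ^ 3 := le_self_pow₀ hB (by norm_num)
  have hB2 : B ^ 2 ≤ B ^ 3 := pow_le_pow_right₀ hB (by norm_num)
  have hB3 : 0 ≤ B ^ 3 := by positivity
  have hBZ : 0 ≤ B ^ 3 * Z := by positivity
  have hBZ2 : 0 ≤ B ^ 3 * Z ^ 2 := by positivity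
  have prod : ∀ {s t : ℝ}, |s| ≤ B → |t| ≤ B → |s * t| ≤ B ^ 3 := fun {s t} hs ht => by
    rw [abs_mul]
    calc |s| * |t| ≤ B * B := by gcongr
      _ = B ^ 2 := by ring
      _ ≤ _ := hB2
  have m1 : |2 * Z * (x₁ * y₁)| ≤ 2 * Z * B ^ 3 := by
    rw [abs_mul, abs_of_nonneg (by positivity : 0 ≤ 2 * Z)]
    gcongr
    exact prod hx₁ hy₁
  have m2 : |Z * (x₀ * y₂)| ≤ Z * B ^ 3 := by
    rw [abs_mul, abs_of_nonneg hZ]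
    gcongr
    exact prod hx₀ hy₂
  have m3 : |Z ^ 2 * (x₀ * y₁ ^ 2)| ≤ Z ^ 2 * B ^ 3 := by
    rw [abs_mul, abs_mul x₀, abs_of_nonneg (by positivity : 0 ≤ Z ^ 2), abs_pow]
    gcongr
    calc _ ≤ B * B ^ 2 := by gcongr
      _ = B ^ 3 := by ring
  have t1 := abs_add_le (x₂ - 2 * Z * (x₁ * y₁) - Z * (x₀ * y₂)) (Z ^ 2 * (x₀ * y₁ ^ 2))
  have t2 := abs_sub (x₂ - 2 * Z * (x₁ * y₁)) (Z * (x₀ * y₂))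
  have t3 := abs_sub x₂ (2 * Z * (x₁ * y₁))
  constructor <;> linarith

theorem HasDerivAt.eq_zero_of_eqOn {f : ℝ → ℝ} {f' η : ℝ} {s : Set ℝ} (hs : IsOpen s) (hη : η ∈ s)
    (hf : ∀ t ∈ s, f t = 0) (h : HasDerivAt f f' η) : f' = 0 :=
  h.unique ((hasDerivAt_const η (0 : ℝ)).congr_of_eventuallyEq
    (Filter.eventually_of_mem (hs.mem_nhds hη) hf))

/-- Kernel bound, uniform over compact parameter sets, for the symbols `χ · a · exp (-Z ν)`. -/
theorem exists_norm_fourierInv_mul_exp_le {E : Type*} [NormedAddCommGroup E] [NormedSpace ℝ E]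
    {U : Set (E × ℝ)} (hU : IsOpen U) {K : Set E} (hK : IsCompact K) {T : Set ℝ} (hT : IsCompact T)
    (hKT : K ×ˢ T ⊆ U) {a ν : E × ℝ → ℝ} (ha : ContDiffOn ℝ 2 a U) (hν : ContDiffOn ℝ 2 ν U)
    (hνpos : ∀ z ∈ K ×ˢ T, 0 < ν z) {χ : ℝ → ℝ} (hχ : ContDiff ℝ 2 χ) (hχT : ∀ η ∉ T, χ η = 0) :
    ∃ κ Λ : ℝ, 0 < κ ∧ 0 ≤ Λ ∧ ∀ p ∈ K, (∀ η, (p, η) ∈ U) → ∀ Z : ℝ, 0 ≤ Z → ∀ v : ℝ,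
      ‖𝓕⁻ (fun η : ℝ => ((χ η * a (p, η) * Real.exp (-(Z * ν (p, η))) : ℝ) : ℂ)) v‖
        ≤ Λ * Real.exp (-(κ * Z)) / (1 + v ^ 2) := by
  have hh : ContDiffOn ℝ 2 (fun z : E × ℝ => χ z.2 * a z) U :=
    (hχ.comp contDiff_snd).contDiffOn.mul ha
  set h : E × ℝ → ℝ := fun z => χ z.2 * a z with hhdef
  obtain ⟨h₁, hh₁, dh⟩ := exists_contDiffOn_hasDerivAt_slice (n := 1) hU (by exact_mod_cast hh)
  obtain ⟨h₂, hh₂, dh₁⟩ := exists_contDiffOn_hasDerivAt_slice (n := 0) hU (by exact_mod_cast hh₁)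
  obtain ⟨ν₁, hν₁, dν⟩ := exists_contDiffOn_hasDerivAt_slice (n := 1) hU (by exact_mod_cast hν)
  obtain ⟨ν₂, hν₂, dν₁⟩ := exists_contDiffOn_hasDerivAt_slice (n := 0) hU (by exact_mod_cast hν₁)
  have hKTc : IsCompact (K ×ˢ T) := hK.prod hT
  obtain ⟨B0, hB0⟩ := hKTc.exists_bound_of_continuousOn (hh.continuousOn.mono hKT)
  obtain ⟨B1, hB1⟩ := hKTc.exists_bound_of_continuousOn (hh₁.continuousOn.mono hKT)
  obtain ⟨B2, hB2⟩ := hKTc.exists_bound_of_continuousOn (hh₂.continuousOn.mono hKT)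
  obtain ⟨B3, hB3⟩ := hKTc.exists_bound_of_continuousOn (hν₁.continuousOn.mono hKT)
  obtain ⟨B4, hB4⟩ := hKTc.exists_bound_of_continuousOn (hν₂.continuousOn.mono hKT)
  obtain ⟨B5, hB5⟩ := hKTc.exists_bound_of_continuousOn
    ((hν.continuousOn.mono hKT).inv₀ fun z hz => (hνpos z hz).ne')
  obtain ⟨R, hR⟩ := hT.isBounded.exists_norm_le
  set B := 1 + |B0| + |B1| + |B2| + |B3| + |B4| with hB
  have hBB : |B0| ≤ B ∧ |B1| ≤ B ∧ |B2| ≤ B ∧ |B3| ≤ B ∧ |B4| ≤ B ∧ 1 ≤ B := by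
    have := abs_nonneg B0; have := abs_nonneg B1; have := abs_nonneg B2
    have := abs_nonneg B3; have := abs_nonneg B4
    refine ⟨?_, ?_, ?_, ?_, ?_, ?_⟩ <;> linarith
  obtain ⟨hBB0, hBB1, hBB2, hBB3, hBB4, hBge⟩ := hBB
  have hBpos : 0 ≤ B := by linarith
  set κ := (1 + |B5|)⁻¹ with hκ
  have hκpos : 0 < κ := by positivity
  have hκν : ∀ z ∈ K ×ˢ T, κ ≤ ν z := fun z hz => by
    have hp := hνpos z hz
    have := hB5 z hz
    rw [Real.norm_eq_abs, Pi.inv_apply, abs_of_pos (inv_pos.2 hp)] at this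
    rw [hκ, inv_le_comm₀ (by positivity) hp]
    have := le_abs_self B5
    linarith
  set Q := 3 * B ^ 3 * (1 + 2 / κ + 8 / κ ^ 2) with hQ
  have hQ0 : 0 ≤ Q := by positivity
  refine ⟨κ / 2, 4 * |R| * Q, by positivity, by positivity, fun p hp hpU Z hZ v => ?_⟩
  have hz0 : ∀ η ∉ T, h (p, η) = 0 := fun η hη => by simp [hhdef, hχT η hη]
  have hz1 : ∀ η ∉ T, h₁ (p, η) = 0 := fun η hη =>
    (dh p η (hpU η)).eq_zero_of_eqOn (s := Tᶜ) hT.isClosed.isOpen_compl hη hz0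
  have hz2 : ∀ η ∉ T, h₂ (p, η) = 0 := fun η hη =>
    (dh₁ p η (hpU η)).eq_zero_of_eqOn (s := Tᶜ) hT.isClosed.isOpen_compl hη hz1
  set e : ℝ → ℝ := fun η => Real.exp (-(Z * ν (p, η))) with he
  have de : ∀ η, HasDerivAt e (e η * (-(Z * ν₁ (p, η)))) η := fun η =>
    ((dν p η (hpU η)).const_mul Z).neg.exp
  set G₁ : ℝ → ℝ := fun η => (h₁ (p, η) - Z * (h (p, η) * ν₁ (p, η))) * e η with hG₁
  set G₂ : ℝ → ℝ := fun η => (h₂ (p, η) - 2 * Z * (h₁ (p, η) * ν₁ (p, η))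
    - Z * (h (p, η) * ν₂ (p, η)) + Z ^ 2 * (h (p, η) * ν₁ (p, η) ^ 2)) * e η with hG₂
  have d1 : ∀ η, HasDerivAt (fun η => h (p, η) * e η) (G₁ η) η := fun η => by
    refine ((dh p η (hpU η)).mul (de η)).congr_deriv ?_
    simp only [hG₁]; ring
  have d2 : ∀ η, HasDerivAt G₁ (G₂ η) η := fun η => by
    refine (((dh₁ p η (hpU η)).sub
      (((dh p η (hpU η)).mul (dν₁ p η (hpU η))).const_mul Z)).mul (de η)).congr_deriv ?_
    simp only [hG₂, Pi.sub_apply, Pi.mul_apply]; ring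
  have slice : ∀ {f : E × ℝ → ℝ}, ContinuousOn f U → Continuous fun η => f (p, η) := fun hf =>
    hf.comp_continuous (by fun_prop) hpU
  have hec : Continuous e :=
     Real.continuous_exp.comp (continuous_const.mul (slice hν.continuousOn)).neg
  have hG₂c : Continuous G₂ := by
    have c0 := slice hh.continuousOn
    have c1 := slice hh₁.continuousOn
    have c2 := slice hh₂.continuousOn
    have c3 := slice hν₁.continuousOn
    have c4 := slice hν₂.continuousOn
    exact (((c2.sub (continuous_const.mul (c1.mul c3))).sub (continuous_const.mul (c0.mul c4))).add
      (continuous_const.mul (c0.mul (c3.pow 2)))).mul hec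
  have bnd : ∀ η, |h (p, η) * e η| ≤ Q * Real.exp (-(κ / 2 * Z)) ∧
      |G₂ η| ≤ Q * Real.exp (-(κ / 2 * Z)) := fun η => by
    by_cases hη : η ∈ T
    · have hm : (p, η) ∈ K ×ˢ T := ⟨hp, hη⟩
      have b0 : |h (p, η)| ≤ B := ((hB0 _ hm).trans (le_abs_self _)).trans hBB0
      have b1 : |h₁ (p, η)| ≤ B := ((hB1 _ hm).trans (le_abs_self _)).trans hBB1
      have b2 : |h₂ (p, η)| ≤ B := ((hB2 _ hm).trans (le_abs_self _)).trans hBB2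
      have b3 : |ν₁ (p, η)| ≤ B := ((hB3 _ hm).trans (le_abs_self _)).trans hBB3
      have b4 : |ν₂ (p, η)| ≤ B := ((hB4 _ hm).trans (le_abs_self _)).trans hBB4
      have hee : e η ≤ Real.exp (-(Z * κ)) := by
        simp only [he]
        gcongr
        exact hκν _ hm
      have he0 : 0 ≤ e η := (Real.exp_pos _).le
      have hfin : ∀ x : ℝ, |x| ≤ 3 * B ^ 3 * (1 + Z + Z ^ 2) →
          |x * e η| ≤ Q * Real.exp (-(κ / 2 * Z)) := fun x hx => by
        rw [abs_mul, abs_of_nonneg he0]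
        calc |x| * e η ≤ (3 * B ^ 3 * (1 + Z + Z ^ 2)) * Real.exp (-(Z * κ)) := by gcongr
          _ = 3 * B ^ 3 * ((1 + Z + Z ^ 2) * Real.exp (-(Z * κ))) := by ring
          _ ≤ 3 * B ^ 3 * ((1 + 2 / κ + 8 / κ ^ 2) * Real.exp (-(κ / 2 * Z))) := by
              gcongr 3 * B ^ 3 * ?_
              exact one_add_add_sq_mul_exp_le hκpos hZ
          _ = _ := by rw [hQ]; ring
      obtain ⟨m0, m2⟩ := abs_le_of_second_derivative_terms hBge hZ b0 b1 b2 b3 b4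
      exact ⟨hfin _ m0, hfin _ m2⟩
    · have q0 : 0 ≤ Q * Real.exp (-(κ / 2 * Z)) := by positivity
      simp only [hG₂, hz0 η hη, hz1 η hη, hz2 η hη]
      simpa using q0
  have main := norm_fourierInv_le_of_hasDerivAt (G := fun η => ((h (p, η) * e η : ℝ) : ℂ))
    (G₁ := fun η => (G₁ η : ℂ)) (G₂ := fun η => (G₂ η : ℂ)) (R := |R|)
    (B := Q * Real.exp (-(κ / 2 * Z))) (fun η => (d1 η).ofReal_comp) (fun η => (d2 η).ofReal_comp)
    (by fun_prop) (abs_nonneg R) (fun η hη => ?_) (fun η => ?_) v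
  · refine main.trans_eq ?_
    ring
  · have hη' : η ∉ T := fun hη' =>
      absurd ((hR η hη').trans (le_abs_self R)) (not_le.2 (by simpa using hη))
    simp [hG₁, hG₂, hz0 η hη', hz1 η hη', hz2 η hη']
  · simpa only [Complex.norm_real, Real.norm_eq_abs] using bnd η

/-- The discriminant of the characteristic equation after rescaling the damping and the
frequency by a common factor. -/
def normalizedDisc (z : (ℝ × ℝ) × ℝ) : ℝ := z.1.1 ^ 2 + 16 * π ^ 2 * z.1.2 ^ 2 * z.2 ^ 2

theorem contDiff_normalizedDisc : ContDiff ℝ 2 normalizedDisc := by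
  unfold normalizedDisc; fun_prop

theorem exists_cutoff_annulus : ∃ χ : ℝ → ℝ, ContDiff ℝ 2 χ ∧
    (∀ η : ℝ, 1 / 2 ≤ |η| → |η| ≤ 2 → χ η = 1) ∧
    ∀ η ∉ Set.Icc (-(9 / 4) : ℝ) (-(1 / 4)) ∪ Set.Icc (1 / 4) (9 / 4), χ η = 0 := by
  let f : ContDiffBump (5 / 4 : ℝ) := ⟨3 / 4, 1, by norm_num, by norm_num⟩
  have hone : ∀ x : ℝ, |x - 5 / 4| ≤ 3 / 4 → f x = 1 := fun x hx =>
    f.one_of_mem_closedBall (by rwa [Metric.mem_closedBall, Real.dist_eq])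
  have hzero : ∀ x : ℝ, 1 ≤ |x - 5 / 4| → f x = 0 := fun x hx =>
    f.zero_of_le_dist (by rwa [Real.dist_eq])
  refine ⟨fun η => f η + f (-η), ?_, fun η h1 h2 => ?_, fun η hη => ?_⟩
  · have h : ContDiff ℝ 2 f := f.contDiff
    exact h.add (h.comp contDiff_neg)
  · rcases le_total 0 η with h | h
    · rw [abs_of_nonneg h] at h1 h2
      simp only
      rw [hone η (abs_le.2 ⟨by linarith, by linarith⟩),
        hzero (-η) (le_abs.2 (Or.inr (by linarith))), add_zero]
    · rw [abs_of_nonpos h] at h1 h2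
      simp only
      rw [hone (-η) (abs_le.2 ⟨by linarith, by linarith⟩),
        hzero η (le_abs.2 (Or.inr (by linarith))), zero_add]
  · simp only [Set.mem_union, Set.mem_Icc, not_or, not_and_or, not_le] at hη
    have key : ∀ x : ℝ, (x < 1 / 4 ∨ 9 / 4 < x) → f x = 0 := fun x hx => hzero x (le_abs.2 (by
      rcases hx with h | h
      · exact Or.inr (by linarith)
      · exact Or.inl (by linarith)))
    simp only
    rw [key η hη.2, key (-η) (hη.1.elim (fun h => Or.inr (by linarith))
      (fun h => Or.inl (by linarith))), add_zero]

theorem exists_norm_fourierInv_normalized_le {χ : ℝ → ℝ} (hχ : ContDiff ℝ 2 χ)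
    (hχT : ∀ η ∉ Set.Icc (-(9 / 4) : ℝ) (-(1 / 4)) ∪ Set.Icc (1 / 4) (9 / 4), χ η = 0)
    {a ν : (ℝ × ℝ) × ℝ → ℝ}
    (ha : ContDiffOn ℝ 2 a {z | 0 < normalizedDisc z ∧ 0 < z.1.1 + √(normalizedDisc z)})
    (hν : ContDiffOn ℝ 2 ν {z | 0 < normalizedDisc z ∧ 0 < z.1.1 + √(normalizedDisc z)})
    (hpos : ∀ z, 0 ≤ z.1.1 → 0 < normalizedDisc z → z.2 ≠ 0 → 0 < ν z) :
    ∃ κ Λ : ℝ, 0 < κ ∧ 0 ≤ Λ ∧ ∀ b c : ℝ, 0 < b → b ≤ 1 → 0 ≤ c → c ≤ 1 → 1 ≤ b + c →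
      ∀ Z, 0 ≤ Z → ∀ v,
      ‖𝓕⁻ (fun η : ℝ => ((χ η * a ((b, c), η) * Real.exp (-(Z * ν ((b, c), η))) : ℝ) : ℂ)) v‖
        ≤ Λ * Real.exp (-(κ * Z)) / (1 + v ^ 2) := by
  have hc := contDiff_normalizedDisc.continuous
  have hU : IsOpen {z | 0 < normalizedDisc z ∧ 0 < z.1.1 + √(normalizedDisc z)} :=
    (isOpen_lt continuous_const hc).inter
      (isOpen_lt continuous_const
      ((continuous_fst.comp continuous_fst).add hc.sqrt))
  have hK : IsCompact ((Set.Icc (0 : ℝ) 1 ×ˢ Set.Icc (0 : ℝ) 1) ∩ {p | 1 ≤ p.1 + p.2}) :=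
    (isCompact_Icc.prod isCompact_Icc).inter_right (isClosed_le continuous_const (by fun_prop))
  have hT : IsCompact (Set.Icc (-(9 / 4) : ℝ) (-(1 / 4)) ∪ Set.Icc (1 / 4) (9 / 4)) :=
    isCompact_Icc.union isCompact_Icc
  have hmem : ∀ z ∈ ((Set.Icc (0 : ℝ) 1 ×ˢ Set.Icc (0 : ℝ) 1) ∩ {p | 1 ≤ p.1 + p.2}) ×ˢ
      (Set.Icc (-(9 / 4) : ℝ) (-(1 / 4)) ∪ Set.Icc (1 / 4) (9 / 4)),
      0 ≤ z.1.1 ∧ 0 < normalizedDisc z ∧ z.2 ≠ 0 := by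
    rintro ⟨⟨b, c⟩, η⟩ ⟨⟨⟨⟨hb, -⟩, hc, -⟩, hbc⟩, hη⟩
    simp only [Set.mem_ofPred_eq] at hb hc hbc hη
    have hη0 : η ≠ 0 := by
      rintro rfl
      rcases hη with h | h
      · linarith [h.2]
      · linarith [h.1]
    refine ⟨hb, ?_, hη0⟩
    simp only [normalizedDisc]
    rcases hb.eq_or_lt with h | h
    · have : 0 < c := by linarith
      positivity
    · positivity
  obtain ⟨κ, Λ, hκ, hΛ, h⟩ := exists_norm_fourierInv_mul_exp_le hU hK hT
    (fun z hz => ⟨(hmem z hz).2.1,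
      add_pos_of_nonneg_of_pos (hmem z hz).1 (Real.sqrt_pos.2 (hmem z hz).2.1)⟩) ha hν
    (fun z hz => hpos z (hmem z hz).1 (hmem z hz).2.1 (hmem z hz).2.2) hχ hχT
  refine ⟨κ, Λ, hκ, hΛ, fun b c hb hb1 hc hc1 hbc => h (b, c) ⟨⟨⟨hb.le, hb1⟩, hc, hc1⟩, hbc⟩
    fun η => ?_⟩
  have : 0 < normalizedDisc ((b, c), η) := by simp only [normalizedDisc]; positivity
  exact ⟨this, by positivity⟩

theorem sqrt_disc_eq (α ξ : ℝ) :
    √(α ^ 2 + 4 * (2 * π * ξ) ^ 2) = √(α ^ 2 + 16 * π ^ 2 * ξ ^ 2) := by ring_nf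

theorem sqrt_disc_eq_mul_normalized {α r η m : ℝ} (hm : 0 < m) :
    √(α ^ 2 + 16 * π ^ 2 * (r * η) ^ 2) = m * √(normalizedDisc ((α / m, r / m), η)) := by
  rw [← Real.sqrt_sq hm.le, ← Real.sqrt_mul (sq_nonneg m), Real.sqrt_sq hm.le]
  congr 1
  simp only [normalizedDisc]
  field_simp

theorem exists_norm_fourierInv_lamP_le {χ : ℝ → ℝ} (hχ : ContDiff ℝ 2 χ)
    (hχT : ∀ η ∉ Set.Icc (-(9 / 4) : ℝ) (-(1 / 4)) ∪ Set.Icc (1 / 4) (9 / 4), χ η = 0) :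
    ∃ κ Λ : ℝ, 0 < κ ∧ 0 ≤ Λ ∧ ∀ α r : ℝ, 0 < α → 0 < r → ∀ Z, 0 ≤ Z → ∀ v,
      ‖𝓕⁻ (fun η : ℝ => ((χ η * (lamP α (2 * π * (r * η)) / √(α ^ 2 + 16 * π ^ 2 * (r * η) ^ 2) *
        Real.exp (-(lamP α (2 * π * (r * η)) * Z))) : ℝ) : ℂ)) v‖
        ≤ Λ * Real.exp (-(κ * (max α r * Z))) / (1 + v ^ 2) := by
  have hq : ContDiffOn ℝ 2 (fun z => √(normalizedDisc z))
      {z | 0 < normalizedDisc z ∧ 0 < z.1.1 + √(normalizedDisc z)} :=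
    contDiff_normalizedDisc.contDiffOn.sqrt fun z hz => hz.1.ne'
  have h1 : ContDiff ℝ 2 fun z : (ℝ × ℝ) × ℝ => z.1.1 := by fun_prop
  obtain ⟨κ, Λ, hκ, hΛ, h⟩ := exists_norm_fourierInv_normalized_le hχ hχT
    (a := fun z => (z.1.1 / √(normalizedDisc z) + 1) / 2)
    (ν := fun z => (z.1.1 + √(normalizedDisc z)) / 2)
    (((h1.contDiffOn.div hq fun z hz => (Real.sqrt_pos.2 hz.1).ne').add contDiffOn_const).div_const
      _)
    ((h1.contDiffOn.add hq).div_const _)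
    (fun z h0 hd _ => by positivity)
  refine ⟨κ, Λ, hκ, hΛ, fun α r hα hr Z hZ v => ?_⟩
  set m := max α r with hm
  have hαm : α ≤ m := le_max_left _ _
  have hrm : r ≤ m := le_max_right _ _
  have hm0 : 0 < m := hα.trans_le hαm
  convert h (α / m) (r / m) (by positivity) ((div_le_one hm0).2 hαm) (by positivity)
    ((div_le_one hm0).2 hrm) (by
      rw [← add_div, le_div_iff₀ hm0, one_mul]
      exact max_le (by linarith) (by linarith)) (m * Z) (by positivity) v using 4 with η
  have hd : 0 < √(normalizedDisc ((α / m, r / m), η)) :=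
    Real.sqrt_pos.2 (by simp only [normalizedDisc]; positivity)
  rw [lamP, sqrt_disc_eq, sqrt_disc_eq_mul_normalized hm0, ← mul_assoc]
  generalize √(normalizedDisc ((α / m, r / m), η)) = σ at *
  dsimp only
  congr 3
  · field_simp
  · field_simp

theorem fourierInv_const_mul (c : ℂ) (f : ℝ → ℂ) (v : ℝ) :
    𝓕⁻ (fun η => c * f η) v = c * 𝓕⁻ f v := by
  rw [fourierInv_real_eq_mul, fourierInv_real_eq_mul, ← integral_const_mul]
  exact integral_congr_ae (Filter.Eventually.of_forall fun η => by ring)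

theorem exists_norm_fourierInv_lamM_le {χ : ℝ → ℝ} (hχ : ContDiff ℝ 2 χ)
    (hχT : ∀ η ∉ Set.Icc (-(9 / 4) : ℝ) (-(1 / 4)) ∪ Set.Icc (1 / 4) (9 / 4), χ η = 0) :
    ∃ κ Λ : ℝ, 0 < κ ∧ 0 ≤ Λ ∧ ∀ α r : ℝ, 0 < α → 0 < r → ∀ Z, 0 ≤ Z → ∀ v,
      ‖𝓕⁻ (fun η : ℝ => ((χ η * (lamM α (2 * π * (r * η)) / √(α ^ 2 + 16 * π ^ 2 * (r * η) ^ 2) *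
        Real.exp (lamM α (2 * π * (r * η)) * Z)) : ℝ) : ℂ)) v‖
        ≤ (r / max α r) ^ 2 * (Λ * Real.exp (-(κ * ((r / max α r) ^ 2 * (max α r * Z)))) /
          (1 + v ^ 2)) := by
  have hq : ContDiffOn ℝ 2 (fun z => √(normalizedDisc z))
      {z | 0 < normalizedDisc z ∧ 0 < z.1.1 + √(normalizedDisc z)} :=
    contDiff_normalizedDisc.contDiffOn.sqrt fun z hz => hz.1.ne'
  have h1 : ContDiff ℝ 2 fun z : (ℝ × ℝ) × ℝ => z.1.1 := by fun_prop
  have h2 : ContDiff ℝ 2 fun z : (ℝ × ℝ) × ℝ => 8 * π ^ 2 * z.2 ^ 2 := by fun_prop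
  have hν : ContDiffOn ℝ 2 (fun z => 8 * π ^ 2 * z.2 ^ 2 / (z.1.1 + √(normalizedDisc z)))
      {z | 0 < normalizedDisc z ∧ 0 < z.1.1 + √(normalizedDisc z)} :=
    h2.contDiffOn.div (h1.contDiffOn.add hq) fun z hz => hz.2.ne'
  obtain ⟨κ, Λ, hκ, hΛ, h⟩ := exists_norm_fourierInv_normalized_le hχ hχT
    (a := fun z => 8 * π ^ 2 * z.2 ^ 2 / (z.1.1 + √(normalizedDisc z)) / √(normalizedDisc z))
    (hν.div hq fun z hz => (Real.sqrt_pos.2 hz.1).ne') hν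
    (fun z h0 hd h2 => by positivity)
  refine ⟨κ, Λ, hκ, hΛ, fun α r hα hr Z hZ v => ?_⟩
  set m := max α r with hm
  have hαm : α ≤ m := le_max_left _ _
  have hrm : r ≤ m := le_max_right _ _
  have hm0 : 0 < m := hα.trans_le hαm
  have key := h (α / m) (r / m) (by positivity) ((div_le_one hm0).2 hαm) (by positivity)
    ((div_le_one hm0).2 hrm) (by
      rw [← add_div, le_div_iff₀ hm0, one_mul]
      exact max_le (by linarith) (by linarith)) ((r / m) ^ 2 * (m * Z)) (by positivity) v
  refine le_trans (le_of_eq ?_) (mul_le_mul_of_nonneg_left key (by positivity))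
  have hc : ‖((-(r / m) ^ 2 : ℝ) : ℂ)‖ = (r / m) ^ 2 := by
    rw [Complex.norm_real, norm_neg, Real.norm_of_nonneg (by positivity)]
  nth_rewrite 1 [← hc]
  rw [← norm_mul, ← fourierInv_const_mul]
  refine congrArg (fun f : ℝ → ℂ => ‖𝓕⁻ f v‖) (funext fun η => ?_)
  have hd0 : 0 < normalizedDisc ((α / m, r / m), η) := by simp only [normalizedDisc]; positivity
  have hd : 0 < √(normalizedDisc ((α / m, r / m), η)) := Real.sqrt_pos.2 hd0
  have hsq := Real.sq_sqrt hd0.le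
  have hM : lamM α (2 * π * (r * η)) = -((r / m) ^ 2 * m * (8 * π ^ 2 * η ^ 2 /
      (α / m + √(normalizedDisc ((α / m, r / m), η))))) := by
    rw [lamM, sqrt_disc_eq, sqrt_disc_eq_mul_normalized hm0]
    have hα' : α = m * (α / m) := by field_simp
    generalize √(normalizedDisc ((α / m, r / m), η)) = σ at *
    simp only [normalizedDisc] at hsq
    have : 0 < α / m + σ := by positivity
    rw [mul_div_assoc', ← neg_div, eq_div_iff this.ne']
    nth_rewrite 1 [hα']
    linear_combination (-m / 2) * hsq
  rw [hM, sqrt_disc_eq_mul_normalized hm0]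
  dsimp only
  generalize √(normalizedDisc ((α / m, r / m), η)) = σ at *
  rw [← Complex.ofReal_mul, ← mul_assoc, ← mul_assoc]
  congr 2
  · field_simp
  · congr 1
    field_simp

theorem lintegral_two_sided_exp_le {a₁ a₂ s₁ s₂ : ℝ} (ha₁ : 0 ≤ a₁) (ha₂ : 0 ≤ a₂) (hs₁ : 0 < s₁)
    (hs₂ : 0 < s₂) :
    ∫⁻ z : ℝ, ENNReal.ofReal
      (if 0 ≤ z then a₁ * Real.exp (-(s₁ * z)) else a₂ * Real.exp (s₂ * z)) ≤
      ENNReal.ofReal (a₁ / s₁ + a₂ / s₂) := by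
  have e₁ : (fun z : ℝ => a₁ * Real.exp (-(s₁ * z))) = fun z => a₁ * Real.exp (-s₁ * z) := by
    simp only [neg_mul]
  rw [← lintegral_add_compl _ (measurableSet_Ioi : MeasurableSet (Set.Ioi (0 : ℝ))), Set.compl_Ioi,
    ENNReal.ofReal_add (by positivity) (by positivity)]
  refine add_le_add (le_of_eq ?_) ?_
  · rw [setLIntegral_congr_fun (g := fun z => ENNReal.ofReal (a₁ * Real.exp (-(s₁ * z))))
      measurableSet_Ioi fun z hz => by simp only [if_pos (Set.mem_Ioi.1 hz).le]]
    rw [← ofReal_integral_eq_lintegral_ofReal, e₁, integral_const_mul,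
      integral_exp_mul_Ioi (by linarith)]
    · simp [div_eq_mul_inv]
    · rw [e₁]
      exact (integrableOn_exp_mul_Ioi (by linarith) _).const_mul _
    · exact Filter.Eventually.of_forall fun z => by positivity
  · rw [setLIntegral_congr (Iio_ae_eq_Iic (a := (0 : ℝ))).symm,
      setLIntegral_congr_fun (g := fun z => ENNReal.ofReal (a₂ * Real.exp (s₂ * z)))
      measurableSet_Iio fun z hz => by simp only [if_neg (not_le.2 (Set.mem_Iio.1 hz))],
      setLIntegral_congr (Iio_ae_eq_Iic (a := (0 : ℝ)))]
    rw [← ofReal_integral_eq_lintegral_ofReal, integral_const_mul, integral_exp_mul_Iic hs₂]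
    · simp [div_eq_mul_inv]
    · exact (integrableOn_exp_mul_Iic hs₂ _).const_mul _
    · exact Filter.Eventually.of_forall fun z => by positivity

theorem lintegral_poisson_weight {r : ℝ} (hr : 0 < r) :
    ∫⁻ u : ℝ, ENNReal.ofReal (r / (1 + (r * u) ^ 2)) = ENNReal.ofReal π := by
  have hi : Integrable fun u : ℝ => r * (1 + (r * u) ^ 2)⁻¹ :=
    (integrable_inv_one_add_sq.comp_mul_left' hr.ne').const_mul r
  simp only [div_eq_mul_inv]
  rw [← ofReal_integral_eq_lintegral_ofReal hi (Filter.Eventually.of_forall fun z => by positivity),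
    integral_const_mul, Measure.integral_comp_mul_left (fun u : ℝ => (1 + u ^ 2)⁻¹),
    integral_univ_inv_one_add_sq, abs_of_pos (inv_pos.2 hr), smul_eq_mul,
    mul_inv_cancel_left₀ hr.ne']

/-- The Fourier symbol, in the second variable, of the convolution kernel of `-𝒟^{(1)}`. -/
def kernelSymbol (α z ξ : ℝ) : ℝ :=
  if 0 ≤ z then lamM α (2 * π * ξ) / √(α ^ 2 + 16 * π ^ 2 * ξ ^ 2) *
    Real.exp (lamM α (2 * π * ξ) * z)
  else lamP α (2 * π * ξ) / √(α ^ 2 + 16 * π ^ 2 * ξ ^ 2) * Real.exp (lamP α (2 * π * ξ) * z)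

theorem continuous_lamP (α : ℝ) : Continuous (lamP α) := by unfold lamP; fun_prop

theorem continuous_lamM (α : ℝ) : Continuous (lamM α) := by unfold lamM; fun_prop

theorem abs_kernelSymbol_le_one {α : ℝ} (hα : 0 < α) (z ξ : ℝ) : |kernelSymbol α z ξ| ≤ 1 := by
  have hS : α ≤ √(α ^ 2 + 16 * π ^ 2 * ξ ^ 2) := Real.le_sqrt_of_sq_le (by
    have : 0 ≤ 16 * π ^ 2 * ξ ^ 2 := by positivity
    linarith)
  rw [kernelSymbol, lamM, lamP, sqrt_disc_eq]
  generalize √(α ^ 2 + 16 * π ^ 2 * ξ ^ 2) = S at *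
  have hS0 : 0 < S := hα.trans_le hS
  split_ifs with hz
  · rw [abs_mul, abs_of_pos (Real.exp_pos _)]
    refine mul_le_one₀ ?_ (Real.exp_pos _).le (Real.exp_le_one_iff.2 ?_)
    · rw [abs_div, abs_of_pos hS0, div_le_one hS0, abs_le]
      constructor <;> linarith
    · exact mul_nonpos_of_nonpos_of_nonneg (by linarith) hz
  · rw [abs_mul, abs_of_pos (Real.exp_pos _)]
    refine mul_le_one₀ ?_ (Real.exp_pos _).le (Real.exp_le_one_iff.2 ?_)
    · rw [abs_div, abs_of_pos hS0, div_le_one hS0, abs_le]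
      constructor <;> linarith
    · exact mul_nonpos_of_nonneg_of_nonpos (by linarith) (not_le.1 hz).le

theorem continuous_kernelSymbol {α : ℝ} (hα : 0 < α) (z : ℝ) : Continuous (kernelSymbol α z) := by
  have hP := continuous_lamP α
  have hM := continuous_lamM α
  have hS : ∀ ξ, √(α ^ 2 + 16 * π ^ 2 * ξ ^ 2) ≠ 0 := fun ξ => by positivity
  unfold kernelSymbol
  split_ifs <;> fun_prop (disch := exact hS)

theorem measurable_kernelSymbol (α : ℝ) : Measurable fun z : ℝ × ℝ => kernelSymbol α z.1 z.2 := by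
  have hP := (continuous_lamP α).measurable
  have hM := (continuous_lamM α).measurable
  unfold kernelSymbol
  exact Measurable.ite (measurableSet_le measurable_const measurable_fst) (by fun_prop)
    (by fun_prop)

theorem integral_kernelSymbol_mul {α : ℝ} (hα : 0 < α) (x ξ : ℝ) {f : ℝ → ℂ} (hf : Integrable f) :
    ∫ y, (kernelSymbol α (x - y) ξ : ℂ) * f y =
      (((α ^ 2 + 16 * π ^ 2 * ξ ^ 2) ^ (-(1:ℝ)/2) : ℝ) : ℂ) *
        ((lamM α (2 * π * ξ) : ℂ) *
            (∫ y in Set.Iic x, (Real.exp (lamM α (2 * π * ξ) * (x - y)) : ℂ) * f y) +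
          (lamP α (2 * π * ξ) : ℂ) *
            ∫ y in Set.Ici x, (Real.exp (lamP α (2 * π * ξ) * (x - y)) : ℂ) * f y) := by
  have hi : Integrable fun y => (kernelSymbol α (x - y) ξ : ℂ) * f y := by
    refine hf.bdd_mul (c := 1) (Measurable.aestronglyMeasurable ?_)
      (Filter.Eventually.of_forall fun y => ?_)
    · exact Complex.measurable_ofReal.comp ((measurable_kernelSymbol α).comp
        (by fun_prop : Measurable fun y : ℝ => (x - y, ξ)))
    · rw [Complex.norm_real]
      exact abs_kernelSymbol_le_one hα _ _
  have hS : (α ^ 2 + 16 * π ^ 2 * ξ ^ 2) ^ (-(1:ℝ)/2) = (√(α ^ 2 + 16 * π ^ 2 * ξ ^ 2))⁻¹ := by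
    rw [Real.sqrt_eq_rpow, ← Real.rpow_neg (by positivity)]
    norm_num
  rw [← integral_add_compl measurableSet_Iic hi, Set.compl_Iic, integral_Ici_eq_integral_Ioi, hS,
    mul_add, ← mul_assoc, ← mul_assoc, ← integral_const_mul, ← integral_const_mul]
  congr 1
  · refine setIntegral_congr_fun measurableSet_Iic fun y hy => ?_
    simp only [kernelSymbol, if_pos (sub_nonneg.2 (Set.mem_Iic.1 hy))]
    push_cast
    ring
  · refine setIntegral_congr_fun measurableSet_Ioi fun y hy => ?_
    simp only [kernelSymbol, if_neg (not_le.2 (sub_neg.2 (Set.mem_Ioi.1 hy)))]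
    push_cast
    ring

theorem integrable_pFT_left (g : 𝓢(ℝ × ℝ, ℂ)) (ξ : ℝ) : Integrable fun y => pFT g y ξ := by
  obtain ⟨C, -, h⟩ := exists_norm_pFT_le g
  refine (integrable_inv_one_add_sq.const_mul C).mono' ?_ (Filter.Eventually.of_forall fun y => h y ξ)
  exact ((continuous_pFT g).comp (by fun_prop : Continuous fun y : ℝ => (y, ξ))).aestronglyMeasurable

theorem Vop_eq (φ₀ : ℝ → ℝ) {α : ℝ} (hα : 0 < α) (j : ℤ) (g : 𝓢(ℝ × ℝ, ℂ)) (x₁ x₂ : ℝ) :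
    Vop φ₀ α j g x₁ x₂ = -𝓕⁻ (fun ξ : ℝ => ∫ y, (kernelSymbol α (x₁ - y) ξ : ℂ) *
      ((φ₀ ((2:ℝ) ^ (-j) * ξ) : ℂ) * pFT g y ξ)) x₂ := by
  rw [Vop]
  refine congrArg (fun f : ℝ → ℂ => -𝓕⁻ f x₂) (funext fun ξ => ?_)
  simp only [mul_left_comm _ (φ₀ ((2:ℝ) ^ (-j) * ξ) : ℂ)]
  rw [integral_const_mul, integral_kernelSymbol_mul hα x₁ ξ (integrable_pFT_left g ξ), mul_assoc]

/-- The localized kernel at frequency `r` has a product majorant whose first factor is bounded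
and has integral of order `1 / max α r`. -/
theorem exists_enorm_fourierInv_kernelSymbol_le {χ : ℝ → ℝ} (hχ : ContDiff ℝ 2 χ)
    (hχT : ∀ η ∉ Set.Icc (-(9 / 4) : ℝ) (-(1 / 4)) ∪ Set.Icc (1 / 4) (9 / 4), χ η = 0) :
    ∃ K : ℝ, 0 < K ∧ ∀ α r : ℝ, 0 < α → 0 < r → ∃ A : ℝ → ℝ≥0∞, Measurable A ∧
      (∀ z, A z ≤ ENNReal.ofReal K) ∧ ∫⁻ z, A z ≤ ENNReal.ofReal (K / max α r) ∧
      ∀ z u, ‖𝓕⁻ (fun ξ : ℝ => ((χ (r⁻¹ * ξ) * kernelSymbol α z ξ : ℝ) : ℂ)) u‖ₑ ≤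
        A z * ENNReal.ofReal (r / (1 + (r * u) ^ 2)) := by
  obtain ⟨κ₁, Λ₁, hκ₁, hΛ₁, h₁⟩ := exists_norm_fourierInv_lamM_le hχ hχT
  obtain ⟨κ₂, Λ₂, hκ₂, hΛ₂, h₂⟩ := exists_norm_fourierInv_lamP_le hχ hχT
  refine ⟨1 + Λ₁ + Λ₂ + Λ₁ / κ₁ + Λ₂ / κ₂, by positivity, fun α r hα hr => ?_⟩
  specialize h₁ α r hα hr
  specialize h₂ α r hα hr
  have hrm : r ≤ max α r := le_max_right _ _
  have hm0 : 0 < max α r := hα.trans_le (le_max_left _ _)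
  generalize max α r = m at *
  have hc0 : 0 < (r / m) ^ 2 := by positivity
  have hc1 : (r / m) ^ 2 ≤ 1 := pow_le_one₀ (by positivity) ((div_le_one hm0).2 hrm)
  refine ⟨fun z => ENNReal.ofReal (if 0 ≤ z then
    (r / m) ^ 2 * Λ₁ * Real.exp (-((κ₁ * ((r / m) ^ 2 * m)) * z))
    else Λ₂ * Real.exp ((κ₂ * m) * z)), ?_, fun z => ?_, ?_, fun z u => ?_⟩
  · exact ENNReal.measurable_ofReal.comp
      (Measurable.ite measurableSet_Ici (by fun_prop) (by fun_prop))
  · refine ENNReal.ofReal_le_ofReal ?_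
    have : 0 ≤ Λ₁ / κ₁ + Λ₂ / κ₂ := by positivity
    split_ifs with hz
    · have : (r / m) ^ 2 * Λ₁ * Real.exp (-((κ₁ * ((r / m) ^ 2 * m)) * z)) ≤ 1 * Λ₁ * 1 := by
        gcongr
        exact Real.exp_le_one_iff.2 (neg_nonpos.2 (by positivity))
      linarith
    · have : Λ₂ * Real.exp ((κ₂ * m) * z) ≤ Λ₂ * 1 := by
        gcongr
        exact Real.exp_le_one_iff.2
          (mul_nonpos_of_nonneg_of_nonpos (by positivity) (not_le.1 hz).le)
      linarith
  · refine (lintegral_two_sided_exp_le (by positivity) hΛ₂ (by positivity) (by positivity)).trans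
      (ENNReal.ofReal_le_ofReal ?_)
    have e : (r / m) ^ 2 * Λ₁ / (κ₁ * ((r / m) ^ 2 * m)) + Λ₂ / (κ₂ * m) =
        (Λ₁ / κ₁ + Λ₂ / κ₂) / m := by
      generalize (r / m) ^ 2 = c at *
      field_simp
    rw [e]
    gcongr
    linarith
  · have hscale : 𝓕⁻ (fun ξ : ℝ => ((χ (r⁻¹ * ξ) * kernelSymbol α z ξ : ℝ) : ℂ)) u =
        r * 𝓕⁻ (fun η : ℝ => ((χ η * kernelSymbol α z (r * η) : ℝ) : ℂ)) (r * u) := by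
      rw [← fourierInv_comp_inv_mul _ hr]
      refine congrArg (fun f : ℝ → ℂ => 𝓕⁻ f u) (funext fun ξ => ?_)
      rw [mul_inv_cancel_left₀ hr.ne']
    rw [hscale, ← ofReal_norm, norm_mul, Complex.norm_real,
      Real.norm_of_nonneg hr.le, ← ENNReal.ofReal_mul (by split_ifs <;> positivity)]
    refine ENNReal.ofReal_le_ofReal ?_
    simp only [kernelSymbol]
    split_ifs with hz
    · refine (mul_le_mul_of_nonneg_left (h₁ z hz (r * u)) hr.le).trans_eq ?_
      have : κ₁ * ((r / m) ^ 2 * (m * z)) = κ₁ * ((r / m) ^ 2 * m) * z := by ring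
      rw [this]
      ring
    · have := h₂ (-z) (by linarith) (r * u)
      simp only [mul_neg, neg_neg] at this
      refine (mul_le_mul_of_nonneg_left this hr.le).trans_eq ?_
      rw [← mul_assoc κ₂]
      ring

theorem integrable_fourierInv_of_enorm_le {f : ℝ → ℂ} (hf : Integrable f) {a : ℝ≥0∞} (ha : a ≠ ∞)
    {r : ℝ} (hr : 0 < r)
    (h : ∀ u, ‖𝓕⁻ f u‖ₑ ≤ a * ENNReal.ofReal (r / (1 + (r * u) ^ 2))) : Integrable (𝓕⁻ f) := by
  refine ⟨?_, ?_⟩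
  · have := continuous_fourierChar_coe
    have hc : Continuous fun x => 𝓕⁻ f x := by
      simp only [fourierInv_real_eq_mul]
      refine continuous_of_dominated (bound := fun v => ‖f v‖) (fun x => ?_) (fun x => ?_) hf.norm
        (Filter.Eventually.of_forall fun v => by fun_prop)
      · exact Continuous.aestronglyMeasurable (by fun_prop) |>.mul hf.1
      · exact Filter.Eventually.of_forall fun v => by rw [norm_mul, Circle.norm_coe, one_mul]
    exact hc.aestronglyMeasurable
  · refine (lintegral_mono h).trans_lt ?_
    rw [lintegral_const_mul _ (by fun_prop), lintegral_poisson_weight hr]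
    exact ENNReal.mul_lt_top ha.lt_top ENNReal.ofReal_lt_top

/-- The mixed-norm estimate for `Vop`, given a majorant `A` of its convolution kernel. -/
theorem mixedNorm_Vop_le {φ₀ : ℝ → ℝ} (hφ : Continuous φ₀)
    (hφ_range : ∀ ξ : ℝ, 0 ≤ φ₀ ξ ∧ φ₀ ξ ≤ 1)
    (hφ_supp : Function.support φ₀ ⊆ {ξ : ℝ | 1/2 ≤ |ξ| ∧ |ξ| ≤ 2}) {χ : ℝ → ℝ}
    (hχ : Continuous χ) (hχ_compact : HasCompactSupport χ)
    (hχ_one : ∀ η : ℝ, 1 / 2 ≤ |η| → |η| ≤ 2 → χ η = 1) {α : ℝ} (hα : 0 < α) (j : ℤ)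
    {A : ℝ → ℝ≥0∞} (hA : Measurable A) {K m : ℝ} (hK : 0 < K) (hm : 0 < m)
    (hAK : ∀ z, A z ≤ ENNReal.ofReal K) (hAL : ∫⁻ z, A z ≤ ENNReal.ofReal (K / m))
    (hker : ∀ z u, ‖𝓕⁻ (fun ξ : ℝ => ((χ (((2 : ℝ) ^ j)⁻¹ * ξ) * kernelSymbol α z ξ : ℝ) : ℂ)) u‖ₑ ≤
        A z * ENNReal.ofReal (2 ^ j / (1 + (2 ^ j * u) ^ 2)))
    (g : 𝓢(ℝ × ℝ, ℂ)) {p₁ p₂ p₃ : ℝ≥0∞} (h2 : 1 ≤ p₂) (h3 : 1 ≤ p₃) (h31 : p₃ ≤ p₁) :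
    mixedNorm p₁ p₂ (Vop φ₀ α j g) ≤
      ENNReal.ofReal (π * K * m ^ (-1 + (1 / p₃).toReal - (1 / p₁).toReal)) *
        mixedNorm p₃ p₂ (LPblock φ₀ j g) := by
  have hr : (0 : ℝ) < 2 ^ j := by positivity
  have hrinv : (2 : ℝ) ^ (-j) = ((2 : ℝ) ^ j)⁻¹ := zpow_neg _ _
  obtain ⟨C, hC, hpC⟩ := exists_norm_pFT_le g
  have hpc := continuous_pFT g
  have hφ_compact : HasCompactSupport φ₀ := by
    refine HasCompactSupport.of_support_subset_isCompact (isCompact_Icc (a := (-2 : ℝ)) (b := 2))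
      fun ξ hξ => abs_le.1 (hφ_supp hξ).2
  set ψ : ℝ → ℝ := fun ξ => φ₀ ((2 : ℝ) ^ (-j) * ξ) with hψ
  have hψc : Continuous ψ := by fun_prop
  have hψi : Integrable ψ := (hφ.integrable_of_hasCompactSupport hφ_compact).comp_mul_left'
    (by positivity)
  have hψn : ∀ ξ, ‖(ψ ξ : ℂ)‖ = ψ ξ := fun ξ => by
    rw [Complex.norm_real, Real.norm_of_nonneg (hφ_range _).1]
  set P : ℝ → ℝ → ℂ := fun y ξ => (ψ ξ : ℂ) * pFT g y ξ with hPdef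
  have hPc : Continuous (Function.uncurry P) := by
    have : Continuous fun z : ℝ × ℝ => pFT g z.1 z.2 := hpc
    simp only [Function.uncurry_def, hPdef]
    fun_prop
  have hPb' : ∀ y ξ, ‖P y ξ‖ ≤ C * (1 + y ^ 2)⁻¹ * ψ ξ := fun y ξ => by
    rw [hPdef, norm_mul, hψn, mul_comm]
    exact mul_le_mul_of_nonneg_right (hpC y ξ) (hφ_range _).1
  have hPb : ∀ y ξ, ‖P y ξ‖ ≤ C * ψ ξ := fun y ξ => (hPb' y ξ).trans (by
    have h0 : 0 ≤ ψ ξ := (hφ_range _).1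
    have : (1 + y ^ 2)⁻¹ ≤ 1 := inv_le_one_of_one_le₀ (by nlinarith [sq_nonneg y])
    gcongr
    exact mul_le_of_le_one_right hC this)
  have hPi : ∀ y, Integrable (P y) := fun y => by
    refine (hψi.const_mul C).mono' ?_ (Filter.Eventually.of_forall (hPb y))
    exact (hPc.comp (by fun_prop : Continuous fun ξ : ℝ => (y, ξ))).aestronglyMeasurable
  have hD : Continuous (Function.uncurry (LPblock φ₀ j g)) :=
    continuous_fourierInv_slice hPc (hψi.const_mul C) hPb
  let k : ℝ → ℝ → ℂ := fun z =>
    𝓕⁻ (fun ξ : ℝ => ((χ (((2 : ℝ) ^ j)⁻¹ * ξ) * kernelSymbol α z ξ : ℝ) : ℂ))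
  have hfc : ∀ z, Continuous fun ξ : ℝ =>
      ((χ (((2 : ℝ) ^ j)⁻¹ * ξ) * kernelSymbol α z ξ : ℝ) : ℂ) := fun z => by
    have := continuous_kernelSymbol hα z
    fun_prop
  have hfi : ∀ z, Integrable fun ξ : ℝ =>
      ((χ (((2 : ℝ) ^ j)⁻¹ * ξ) * kernelSymbol α z ξ : ℝ) : ℂ) := fun z => by
    refine Integrable.mono' (g := fun ξ => ‖χ (((2 : ℝ) ^ j)⁻¹ * ξ)‖) ?_
      (hfc z).aestronglyMeasurable (Filter.Eventually.of_forall fun ξ => ?_)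
    · exact ((hχ.integrable_of_hasCompactSupport hχ_compact).comp_mul_left'
        (inv_ne_zero hr.ne')).norm
    · rw [Complex.norm_real, norm_mul]
      exact mul_le_of_le_one_right (norm_nonneg _) (abs_kernelSymbol_le_one hα z ξ)
  have hki : ∀ z, Integrable (k z) := fun z => integrable_fourierInv_of_enorm_le (hfi z)
    (ne_top_of_le_ne_top ENNReal.ofReal_ne_top (hAK z)) hr (hker z)
  have hkF : ∀ z ξ, 𝓕 (k z) ξ = ((χ (((2 : ℝ) ^ j)⁻¹ * ξ) * kernelSymbol α z ξ : ℝ) : ℂ) :=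
    fun z ξ => congrFun ((hfc z).fourier_fourierInv_eq (hfi z) (by
      have := (hki z).comp_neg
      simpa only [k, Real.fourierInv_eq_fourier_neg, neg_neg] using this)) ξ
  have hV : ∀ x₁, eLpNorm (Vop φ₀ α j g x₁) p₂ volume ≤ ENNReal.ofReal π *
      ∫⁻ y, A (x₁ - y) * eLpNorm (LPblock φ₀ j g y) p₂ volume := fun x₁ => by
    rw [← lintegral_poisson_weight hr]
    refine eLpNorm_le_of_enorm_le_lintegral hD (A := fun y => A (x₁ - y)) (by fun_prop)
      (by fun_prop) h2 fun x₂ => ?_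
    rw [Vop_eq φ₀ hα, enorm_neg]
    refine (enorm_fourierInv_integral_le (P := P) (M := fun y ξ => (kernelSymbol α (x₁ - y) ξ : ℂ))
      (k := fun y => k (x₁ - y)) hPi ?_ (fun y => hki _) (fun y ξ => ?_) x₂).trans ?_
    · refine Integrable.mono' (g := fun z : ℝ × ℝ => C * (1 + z.1 ^ 2)⁻¹ * ψ z.2)
        ((integrable_inv_one_add_sq.const_mul C).mul_prod hψi) ?_
        (Filter.Eventually.of_forall fun z => ?_)
      · refine (Measurable.aestronglyMeasurable ?_).mul hPc.aestronglyMeasurable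
        exact Complex.measurable_ofReal.comp ((measurable_kernelSymbol α).comp
          (by fun_prop : Measurable fun z : ℝ × ℝ => (x₁ - z.1, z.2)))
      · simp only [Function.uncurry_def, norm_mul, Complex.norm_real (kernelSymbol _ _ _)]
        exact (mul_le_of_le_one_left (norm_nonneg _) (abs_kernelSymbol_le_one hα _ _)).trans
          (hPb' _ _)
    · rw [hkF]
      by_cases h0 : ψ ξ = 0
      · simp [hPdef, h0]
      · have hs := hφ_supp (Function.mem_support.2 h0)
        rw [hrinv] at hs
        rw [hχ_one _ hs.1 hs.2, one_mul]
    · refine lintegral_mono fun y => lintegral_mono fun u => ?_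
      exact mul_le_mul' (hker (x₁ - y) u) le_rfl
  refine (mixedNorm_le_of_slice_le hD hA hAK hAL h3 h31 hV).trans_eq ?_
  congr 1
  have ht : (1 / p₃).toReal ≤ 1 := by
    rw [one_div]
    exact ENNReal.toReal_mono ENNReal.one_ne_top (ENNReal.inv_le_one.2 h3)
  have ht' : (1 / p₁).toReal ≤ (1 / p₃).toReal := by
    rw [one_div, one_div]
    exact ENNReal.toReal_mono (ne_top_of_le_ne_top ENNReal.one_ne_top (ENNReal.inv_le_one.2 h3))
      (ENNReal.inv_le_inv.2 h31)
  have ht0 : 0 ≤ (1 / p₁).toReal := ENNReal.toReal_nonneg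
  generalize (1 / p₃).toReal = s at *
  generalize (1 / p₁).toReal = t at *
  rw [ENNReal.ofReal_rpow_of_pos hK, ENNReal.ofReal_rpow_of_pos (by positivity),
    ← ENNReal.ofReal_mul (by positivity), ← ENNReal.ofReal_mul (by positivity)]
  congr 1
  rw [Real.div_rpow hK.le hm.le, mul_div_assoc', ← Real.rpow_add hK, mul_assoc]
  have e1 : s - t + (1 - s + t) = 1 := by ring
  have e2 : -1 + s - t = -(1 - s + t) := by ring
  rw [e1, e2, Real.rpow_one, Real.rpow_neg hm.le, div_eq_mul_inv]
/-- mixed-norm estimates for the block of `𝒟^{(1)}[g]`. -/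
theorem statement16 (φ₀ : ℝ → ℝ)
    (hφ_smooth : ContDiff ℝ (⊤ : ℕ∞) φ₀)
    (hφ_range : ∀ ξ : ℝ, 0 ≤ φ₀ ξ ∧ φ₀ ξ ≤ 1)
    (hφ_supp : Function.support φ₀ ⊆ {ξ : ℝ | 1/2 ≤ |ξ| ∧ |ξ| ≤ 2})
    (hφ_sum : ∀ ξ : ℝ, ξ ≠ 0 → HasSum (fun j : ℤ => φ₀ ((2:ℝ) ^ (-j) * ξ)) 1) :
    ∃ C : ℝ, 0 < C ∧
      ∀ (α : ℝ), 0 < α → ∀ (g : 𝓢(ℝ × ℝ, ℂ)) (j : ℤ) (p₁ p₂ p₃ : ℝ≥0∞),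
        1 ≤ p₁ → 1 ≤ p₂ → 1 ≤ p₃ → p₃ ≤ p₁ →
        ((2:ℝ) ^ j > α →
          mixedNorm p₁ p₂ (Vop φ₀ α j ⇑g)
            ≤ ENNReal.ofReal
                (C * (2:ℝ) ^ ((-1 + (1/p₃).toReal - (1/p₁).toReal) * (j : ℝ))) *
              mixedNorm p₃ p₂ (LPblock φ₀ j ⇑g)) ∧
        ((2:ℝ) ^ j ≤ α →
          mixedNorm p₁ p₂ (Vop φ₀ α j ⇑g)
            ≤ ENNReal.ofReal
                (C * α ^ (-1 + (1/p₃).toReal - (1/p₁).toReal)) *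
              mixedNorm p₃ p₂ (LPblock φ₀ j ⇑g)) := by
  obtain ⟨χ, hχ, hχ_one, hχ_zero⟩ := exists_cutoff_annulus
  have hχ_compact : HasCompactSupport χ :=
    HasCompactSupport.intro (isCompact_Icc.union isCompact_Icc) hχ_zero
  obtain ⟨K, hK, h⟩ := exists_enorm_fourierInv_kernelSymbol_le hχ hχ_zero
  refine ⟨π * K, by positivity, fun α hα g j p₁ p₂ p₃ _ h2 h3 h31 => ?_⟩
  have hr : (0 : ℝ) < 2 ^ j := by positivity
  obtain ⟨A, hA, hAK, hAL, hker⟩ := h α (2 ^ j) hα hr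
  have key := mixedNorm_Vop_le hφ_smooth.continuous hφ_range hφ_supp hχ.continuous hχ_compact
    hχ_one hα j hA hK (lt_max_of_lt_left hα) hAK hAL hker g h2 h3 h31
  refine ⟨fun hj => ?_, fun hj => ?_⟩
  · rwa [max_eq_right hj.le, ← Real.rpow_intCast, ← Real.rpow_mul zero_le_two,
      mul_comm (j : ℝ)] at key
  · rwa [max_eq_left hj] at key
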